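/- There exists an integer k₀ such that for all k ≥ k₀, all r ≥ 2 and all ω ≤ √(ln k/(ln ln k)): Δ(H(k,r,ω)) > r^{k−1} · k^{−4·⌊√(ln k / ln(2 ln k))⌋^{−1}}. -/

import Mathlib

open Finset Filter

open scoped Classical

namespace HG

/-- A finset `e` is monochromatic under the coloring `c`. -/
def Monochromatic {V α : Type*} (c : V → α) (e : Finset V) : Prop :=
  ∀ v ∈ e, ∀ w ∈ e, c v = c w

/-- The hypergraph with edge set `E` admits a proper coloring with `r` colors. -/
def RColorable {V : Type*} (r : ℕ) (E : Finset (Finset V)) : Prop :=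
  ∃ c : V → Fin r, ∀ e ∈ E, ¬ Monochromatic c e

/-- The hypergraph with edge set `E` is `r`-choosable: for every assignment of
color lists of size `r` there is a proper coloring from the lists. -/
def RChoosable {V : Type*} (r : ℕ) (E : Finset (Finset V)) : Prop :=
  ∀ L : V → Finset ℕ, (∀ v, (L v).card = r) →
    ∃ c : V → ℕ, (∀ v, c v ∈ L v) ∧ ∀ e ∈ E, ¬ Monochromatic c e

/-- Probability that the binomial random hypergraph `H(n,k,p)` (each of the
`C(n,k)` possible `k`-element edges present independently with probability `p`)
satisfies the property `P` of its edge set. -/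
noncomputable def hyperProb (n k : ℕ) (p : ℝ)
    (P : Finset (Finset (Fin n)) → Prop) : ℝ :=
  ∑ E ∈ ((Finset.univ : Finset (Fin n)).powersetCard k).powerset,
    if P E then
      p ^ E.card *
        (1 - p) ^ (((Finset.univ : Finset (Fin n)).powersetCard k).card - E.card)
    else 0

/-- Maximum vertex degree of the hypergraph with edge set `E`. -/
def maxDegree {V : Type*} [DecidableEq V] (E : Finset (Finset V)) : ℕ :=
  (E.biUnion id).sup fun v => (E.filter fun e => v ∈ e).card

/-- Three distinct edges forming a 3-cycle (triangle). -/
def IsTriangle {V : Type*} [DecidableEq V] (e f h : Finset V) : Prop :=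
  e ≠ f ∧ e ≠ h ∧ f ≠ h ∧ ((e ∩ f) \ h).Nonempty ∧ ((e ∩ h) \ f).Nonempty ∧
    ((f ∩ h) \ e).Nonempty

/-- A hypergraph is 2-simple if any two distinct edges share at most 2 vertices. -/
def TwoSimple {V : Type*} [DecidableEq V] (E : Finset (Finset V)) : Prop :=
  ∀ e ∈ E, ∀ f ∈ E, e ≠ f → (e ∩ f).card ≤ 2

/-- The number of 3-cycles of the hypergraph `E` containing the edge `e`. -/
noncomputable def triCount {V : Type*} [DecidableEq V]
    (E : Finset (Finset V)) (e : Finset V) : ℕ :=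
  ((E.powersetCard 2).filter fun s =>
    ∃ f ∈ s, ∃ h ∈ s, f ≠ h ∧ IsTriangle e f h).card

/-- The function `φ(k) = 4⌊√(ln k / ln (2 ln k))⌋⁻¹`. -/
noncomputable def phi (k : ℕ) : ℝ :=
  4 * ((⌊Real.sqrt (Real.log k / Real.log (2 * Real.log k))⌋₊ : ℝ))⁻¹

end HG

namespace HG

section LocalLemma

variable {V S : Type*} [DecidableEq V]

/-- The set of assignments `G` is closed under changing the values at vertices of `D`. -/
def UpdateClosed (G : Finset (V → S)) (D : Finset V) : Prop :=
  ∀ ω ∈ G, ∀ u ∈ D, ∀ s, Function.update ω u s ∈ G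

lemma UpdateClosed.mono {G : Finset (V → S)} {D D' : Finset V} (h : UpdateClosed G D)
    (hD : D' ⊆ D) : UpdateClosed G D' :=
  fun ω hω u hu s => h ω hω u (hD hu) s

lemma UpdateClosed.filter {G : Finset (V → S)} {D : Finset V} (h : UpdateClosed G D)
    {Q : (V → S) → Prop} (hQ : ∀ ω, ∀ u ∈ D, ∀ s, Q ω → Q (Function.update ω u s)) :
    UpdateClosed (G.filter Q) D := by
  intro ω hω u hu s
  rw [mem_filter] at hω ⊢
  exact ⟨h ω hω.1 u hu s, hQ ω u hu s hω.2⟩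

lemma card_filter_update_le [Fintype S] [Nonempty S] (G : Finset (V → S)) (a : V)
    (X : (V → S) → S → Prop) (q : ℝ) (hG : ∀ ω ∈ G, ∀ s, Function.update ω a s ∈ G)
    (hX : ∀ ω s x, X (Function.update ω a s) x ↔ X ω x)
    (hq : ∀ ω, ((univ.filter (X ω)).card : ℝ) ≤ q * Fintype.card S) :
    ((G.filter fun ω => X ω (ω a)).card : ℝ) ≤ q * G.card := by
  have hS : (0 : ℝ) < Fintype.card S := by exact_mod_cast Fintype.card_pos
  have h1 : ((G.filter fun ω => X ω (ω a)) ×ˢ (univ : Finset S)).card ≤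
      (G.sigma fun ω => univ.filter (X ω)).card := by
    refine Finset.card_le_card_of_injOn
      (fun p => (⟨Function.update p.1 a p.2, p.1 a⟩ : Σ _ : V → S, S)) ?_ ?_
    · rintro ⟨ω, s⟩ h
      simp only [coe_product, coe_univ, Set.mem_prod, mem_coe, mem_filter, Set.mem_univ,
        and_true] at h
      simp only [coe_sigma, Set.mem_sigma_iff, mem_coe, mem_filter, mem_univ, true_and]
      exact ⟨hG ω h.1 s, (hX ω s _).2 h.2⟩
    · rintro ⟨ω, s⟩ - ⟨ω', s'⟩ - h
      simp only [Sigma.mk.injEq, heq_eq_eq] at h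
      obtain ⟨h, h'⟩ := h
      have hs : s = s' := by simpa using congrFun h a
      have hω : ω = ω' := by
        funext v
        by_cases hv : v = a
        · subst hv; exact h'
        · simpa [hv] using congrFun h v
      rw [hs, hω]
  rw [card_product, card_sigma, card_univ] at h1
  have h2 : ((G.filter fun ω => X ω (ω a)).card : ℝ) * Fintype.card S ≤
      ∑ ω ∈ G, ((univ.filter (X ω)).card : ℝ) := by exact_mod_cast h1
  have h3 : ∑ ω ∈ G, ((univ.filter (X ω)).card : ℝ) ≤ G.card * (q * Fintype.card S) := by
    rw [← nsmul_eq_mul]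
    exact Finset.sum_le_card_nsmul _ _ _ fun ω _ => hq ω
  refine le_of_mul_le_mul_right ?_ hS
  linarith

/-- Bound for the number of assignments satisfying, at each vertex of `D`, a condition that may
depend on the values outside `D`. -/
lemma card_filter_forall_le [Fintype S] [Nonempty S] (D : Finset V)
    (X : (V → S) → V → S → Prop) (q : V → ℝ)
    (hX : ∀ ω, ∀ u ∈ D, ∀ s, ∀ w ∈ D, ∀ x, X (Function.update ω u s) w x ↔ X ω w x)
    (hq : ∀ u ∈ D, ∀ ω, ((univ.filter (X ω u)).card : ℝ) ≤ q u * Fintype.card S)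
    (G : Finset (V → S)) (hG : UpdateClosed G D) :
    ((G.filter fun ω => ∀ u ∈ D, X ω u (ω u)).card : ℝ) ≤ (∏ u ∈ D, q u) * G.card := by
  have hS : (0 : ℝ) < Fintype.card S := by exact_mod_cast Fintype.card_pos
  induction D using Finset.induction_on generalizing G with
  | empty => simp
  | insert a D ha ih =>
    rcases G.eq_empty_or_nonempty with rfl | ⟨ω₀, -⟩
    · simp
    have hq0 : ∀ u ∈ D, 0 ≤ q u := fun u hu => by
      have := (Nat.cast_nonneg _).trans (hq u (mem_insert_of_mem hu) ω₀)
      exact nonneg_of_mul_nonneg_left this hS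
    have hG' : UpdateClosed (G.filter fun ω => X ω a (ω a)) D := by
      refine (hG.mono (subset_insert a D)).filter fun ω u hu s h => ?_
      have hau : a ≠ u := fun h => ha (h ▸ hu)
      rw [hX ω u (mem_insert_of_mem hu) s a (mem_insert_self a D), Function.update_of_ne hau]
      exact h
    have h1 := ih (fun ω u hu s w hw => hX ω u (mem_insert_of_mem hu) s w (mem_insert_of_mem hw))
      (fun u hu => hq u (mem_insert_of_mem hu)) _ hG'
    have h2 := card_filter_update_le G a (fun ω => X ω a) (q a)
      (fun ω hω s => hG ω hω a (mem_insert_self a D) s)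
      (fun ω s => hX ω a (mem_insert_self a D) s a (mem_insert_self a D))
      (hq a (mem_insert_self a D))
    rw [filter_filter] at h1
    simp only [forall_mem_insert]
    rw [prod_insert ha]
    calc _ ≤ _ := h1
      _ ≤ (∏ u ∈ D, q u) * (q a * G.card) :=
        mul_le_mul_of_nonneg_left h2 (prod_nonneg hq0)
      _ = _ := by ring

lemma card_le_of_forall [Fintype S] [Nonempty S] (D : Finset V)
    (X : (V → S) → V → S → Prop) (q : V → ℝ)
    (hX : ∀ ω, ∀ u ∈ D, ∀ s, ∀ w ∈ D, ∀ x, X (Function.update ω u s) w x ↔ X ω w x)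
    (hq : ∀ u ∈ D, ∀ ω, ∃ T : Finset S, (∀ s, X ω u s → s ∈ T) ∧
      (T.card : ℝ) ≤ q u * Fintype.card S)
    (G : Finset (V → S)) (hG : UpdateClosed G D) (H : Finset (V → S)) (hHG : H ⊆ G)
    (hH : ∀ ω ∈ H, ∀ u ∈ D, X ω u (ω u)) :
    (H.card : ℝ) ≤ (∏ u ∈ D, q u) * G.card :=
  (Nat.cast_le.2 (card_le_card fun ω hω => mem_filter.2 ⟨hHG hω, hH ω hω⟩)).trans
    (card_filter_forall_le D X q hX (fun u hu ω => by
      obtain ⟨T, hT, hc⟩ := hq u hu ω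
      exact (Nat.cast_le.2 (card_le_card fun s hs => hT s (mem_filter.1 hs).2)).trans hc) G hG)

/-- The assignments in `Ω` avoiding all events of the family that are determined inside `W`. -/
noncomputable def avoiding {ι : Type*} (Ω : Finset (V → S)) (I : Finset ι) (D : ι → Finset V)
    (ev : ι → (V → S) → Prop) (W : Finset V) : Finset (V → S) :=
  Ω.filter fun ω => ∀ i ∈ I, D i ⊆ W → ¬ ev i ω

lemma mem_avoiding {ι : Type*} {Ω : Finset (V → S)} {I : Finset ι} {D : ι → Finset V}
    {ev : ι → (V → S) → Prop} {W : Finset V} {ω : V → S} :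
    ω ∈ avoiding Ω I D ev W ↔ ω ∈ Ω ∧ ∀ i ∈ I, D i ⊆ W → ¬ ev i ω :=
  mem_filter

lemma avoiding_anti {ι : Type*} {Ω : Finset (V → S)} {I : Finset ι} {D : ι → Finset V}
    {ev : ι → (V → S) → Prop} {W W' : Finset V} (h : W' ⊆ W) :
    avoiding Ω I D ev W ⊆ avoiding Ω I D ev W' := by
  intro ω hω
  rw [mem_avoiding] at hω ⊢
  exact ⟨hω.1, fun i hi hDi => hω.2 i hi (hDi.trans h)⟩

lemma avoiding_erase_subset {ι : Type*} (Ω : Finset (V → S)) (I : Finset ι) (D : ι → Finset V)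
    (ev : ι → (V → S) → Prop) (W : Finset V) (v : V) :
    avoiding Ω I D ev (W.erase v) ⊆ avoiding Ω I D ev W ∪ (I.filter fun i => v ∈ D i).biUnion
      fun i => (avoiding Ω I D ev (W.erase v \ D i)).filter (ev i) := by
  intro ω hω
  by_cases h : ω ∈ avoiding Ω I D ev W
  · exact mem_union_left _ h
  refine mem_union_right _ ?_
  have hω' := mem_avoiding.1 hω
  have h' : ∃ i ∈ I, D i ⊆ W ∧ ev i ω := by
    by_contra! hcon
    exact h (mem_avoiding.2 ⟨hω'.1, hcon⟩)
  obtain ⟨i, hi, hDi, hevi⟩ := h'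
  have hvi : v ∈ D i := by
    by_contra hvi
    exact hω'.2 i hi (fun u hu => mem_erase.2 ⟨fun h => hvi (h ▸ hu), hDi hu⟩) hevi
  rw [mem_biUnion]
  exact ⟨i, mem_filter.2 ⟨hi, hvi⟩, mem_filter.2 ⟨avoiding_anti sdiff_subset hω, hevi⟩⟩

lemma updateClosed_avoiding {ι : Type*} {Ω : Finset (V → S)} {I : Finset ι} {D : ι → Finset V}
    {ev : ι → (V → S) → Prop} {A : Finset V} (W : Finset V) (hΩ : UpdateClosed Ω A)
    (hev : ∀ i ∈ I, ∀ ω, ∀ u ∉ D i, ∀ s, ev i (Function.update ω u s) ↔ ev i ω) :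
    UpdateClosed (avoiding Ω I D ev (W \ A)) A := by
  intro ω hω u hu s
  rw [mem_avoiding] at hω ⊢
  refine ⟨hΩ ω hω.1 u hu s, fun j hj hDj h => hω.2 j hj hDj ?_⟩
  have huj : u ∉ D j := fun h' => (Finset.mem_sdiff.1 (hDj h')).2 hu
  exact (hev j hj ω u huj s).1 h

lemma exists_updateClosed [Fintype S] [Nonempty S] (U : Finset V) :
    ∃ Ω : Finset (V → S), Ω.Nonempty ∧ UpdateClosed Ω U := by
  obtain ⟨s₀⟩ := ‹Nonempty S›
  refine ⟨(univ : Finset (U → S)).image (fun f v => if h : v ∈ U then f ⟨v, h⟩ else s₀),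
    ⟨_, mem_image_of_mem _ (mem_univ fun _ => s₀)⟩, ?_⟩
  intro ω hω u hu s
  rw [mem_image] at hω ⊢
  obtain ⟨f, -, rfl⟩ := hω
  refine ⟨Function.update f ⟨u, hu⟩ s, mem_univ _, ?_⟩
  funext v
  by_cases hv : v = u
  · subst hv; simp [hu]
  · by_cases hvU : v ∈ U
    · simp [hv, hvU]
    · simp [hv, hvU]

/-- A local lemma for a finite family of events in a product space, each event `i` depending
only on the coordinates in `D i` and having probability at most `P i`. -/
theorem exists_forall_not_of_sum_le [Fintype S] [Nonempty S] {ι : Type*} (I : Finset ι)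
    (D : ι → Finset V) (ev : ι → (V → S) → Prop) (P : ι → ℝ) (τ : ℝ) (hτ0 : 0 ≤ τ) (hτ1 : τ < 1)
    (hD : ∀ i ∈ I, (D i).Nonempty)
    (hev : ∀ i ∈ I, ∀ ω, ∀ u ∉ D i, ∀ s, ev i (Function.update ω u s) ↔ ev i ω)
    (hP0 : ∀ i ∈ I, 0 ≤ P i)
    (hP : ∀ i ∈ I, ∀ G : Finset (V → S), UpdateClosed G (D i) →
      ((G.filter (ev i)).card : ℝ) ≤ P i * G.card)
    (hsum : ∀ v, ∑ i ∈ I, (if v ∈ D i then P i * ((1 - τ)⁻¹) ^ (D i).card else 0) ≤ τ) :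
    ∃ ω : V → S, ∀ i ∈ I, ¬ ev i ω := by
  obtain ⟨Ω, hΩne, hΩc⟩ := exists_updateClosed (S := S) (I.biUnion D)
  have hpos : (0 : ℝ) < 1 - τ := by linarith
  have hone : 1 ≤ (1 - τ)⁻¹ := (one_le_inv₀ hpos).2 (by linarith)
  have key : ∀ W : Finset V, ∀ W' ⊆ W, ((avoiding Ω I D ev W').card : ℝ) ≤
      ((1 - τ)⁻¹) ^ (W \ W').card * (avoiding Ω I D ev W).card := by
    intro W
    induction W using Finset.strongInduction with
    | H W ih =>
    intro W' hW'
    rcases (W \ W').eq_empty_or_nonempty with h0 | ⟨v, hv⟩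
    · rw [h0]
      have : W = W' := (sdiff_eq_empty_iff_subset.1 h0).antisymm hW'
      simp [this]
    rw [Finset.mem_sdiff] at hv
    have hss : W.erase v ⊂ W := erase_ssubset hv.1
    have hW'0 : W' ⊆ W.erase v := fun u hu => mem_erase.2 ⟨fun h => hv.2 (h ▸ hu), hW' hu⟩
    have hterm : ∀ i ∈ I,
        (((avoiding Ω I D ev (W.erase v \ D i)).filter (ev i)).card : ℝ) ≤
        P i * ((1 - τ)⁻¹) ^ (D i).card * (avoiding Ω I D ev (W.erase v)).card := by
      intro i hi
      have h1 := hP i hi _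
        (updateClosed_avoiding (W.erase v) (hΩc.mono (subset_biUnion_of_mem D hi)) hev)
      have h2 := ih (W.erase v) hss (W.erase v \ D i) sdiff_subset
      have h3 : (W.erase v \ (W.erase v \ D i)).card ≤ (D i).card := by
        refine card_le_card fun u hu => ?_
        rw [Finset.mem_sdiff, Finset.mem_sdiff] at hu
        by_contra hcon
        exact hu.2 ⟨hu.1, hcon⟩
      calc _ ≤ _ := h1
        _ ≤ _ := mul_le_mul_of_nonneg_left h2 (hP0 i hi)
        _ ≤ P i * (((1 - τ)⁻¹) ^ (D i).card * (avoiding Ω I D ev (W.erase v)).card) := by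
          refine mul_le_mul_of_nonneg_left ?_ (hP0 i hi)
          refine mul_le_mul_of_nonneg_right ?_ (Nat.cast_nonneg _)
          exact pow_le_pow_right₀ hone h3
        _ = _ := by ring
    have hc : ((avoiding Ω I D ev (W.erase v)).card : ℝ) ≤ (avoiding Ω I D ev W).card +
        ∑ i ∈ I.filter (fun i => v ∈ D i),
          (((avoiding Ω I D ev (W.erase v \ D i)).filter (ev i)).card : ℝ) := by
      have := (card_le_card (avoiding_erase_subset Ω I D ev W v)).trans
        ((card_union_le _ _).trans (Nat.add_le_add_left card_biUnion_le _))
      exact_mod_cast this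
    have hs : ∑ i ∈ I.filter (fun i => v ∈ D i),
        (((avoiding Ω I D ev (W.erase v \ D i)).filter (ev i)).card : ℝ) ≤
        τ * (avoiding Ω I D ev (W.erase v)).card := by
      calc _ ≤ ∑ i ∈ I.filter (fun i => v ∈ D i),
            P i * ((1 - τ)⁻¹) ^ (D i).card * (avoiding Ω I D ev (W.erase v)).card :=
          sum_le_sum fun i hi => hterm i (mem_filter.1 hi).1
        _ = (∑ i ∈ I, (if v ∈ D i then P i * ((1 - τ)⁻¹) ^ (D i).card else 0)) *
            (avoiding Ω I D ev (W.erase v)).card := by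
          rw [← sum_mul, sum_filter]
        _ ≤ _ := mul_le_mul_of_nonneg_right (hsum v) (Nat.cast_nonneg _)
    have hcard : (W \ W').card = (W.erase v \ W').card + 1 := by
      have : W \ W' = insert v (W.erase v \ W') := by
        ext u
        by_cases hu : u = v
        · subst hu; simp [hv.1, hv.2]
        · simp [hu]
      rw [this, card_insert_of_notMem (by simp)]
    have h2 : ((avoiding Ω I D ev (W.erase v)).card : ℝ) ≤
        (1 - τ)⁻¹ * (avoiding Ω I D ev W).card := by
      rw [← div_eq_inv_mul, le_div_iff₀ hpos]
      linarith
    calc _ ≤ _ := ih (W.erase v) hss W' hW'0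
      _ ≤ ((1 - τ)⁻¹) ^ (W.erase v \ W').card * ((1 - τ)⁻¹ * (avoiding Ω I D ev W).card) :=
        mul_le_mul_of_nonneg_left h2 (by positivity)
      _ = _ := by rw [hcard, pow_succ]; ring
  have h0 : avoiding Ω I D ev ∅ = Ω := by
    refine filter_true_of_mem fun ω _ i hi hDi => ?_
    exact absurd (subset_empty.1 hDi) (hD i hi).ne_empty
  have hlast := key (I.biUnion D) ∅ (empty_subset _)
  have hne : (avoiding Ω I D ev (I.biUnion D)).Nonempty := by
    rw [← card_pos]
    by_contra hcon
    have hz : ((avoiding Ω I D ev (I.biUnion D)).card : ℝ) = 0 := by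
      exact_mod_cast Nat.eq_zero_of_not_pos hcon
    rw [h0, hz, mul_zero] at hlast
    have : (0 : ℝ) < Ω.card := by exact_mod_cast hΩne.card_pos
    linarith
  obtain ⟨ω, hω⟩ := hne
  exact ⟨ω, fun i hi => (mem_avoiding.1 hω).2 i hi (subset_biUnion_of_mem D hi)⟩

end LocalLemma

section States

/-- The random data attached to a vertex: an ordered pair of distinct colors (the initial color
and the color used for recoloring), and a number deciding whether recoloring is allowed. -/
abbrev State (r k : ℕ) : Type := {p : Fin r × Fin r // p.1 ≠ p.2} × Fin k

variable {r k : ℕ}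

/-- The initial color. -/
def State.col (s : State r k) : Fin r := s.1.1.1

/-- The color used for recoloring. -/
def State.alt (s : State r k) : Fin r := s.1.1.2

/-- The vertex may be recolored. -/
def State.Free (J : ℕ) (s : State r k) : Prop := (s.2 : ℕ) < J

lemma State.col_ne_alt (s : State r k) : s.col ≠ s.alt := s.1.2

lemma card_state : Fintype.card (State r k) = r * (r - 1) * k := by
  have h : Fintype.card {p : Fin r × Fin r // p.1 ≠ p.2} = r * (r - 1) := by
    rw [Fintype.card_subtype]
    have : (univ.filter fun p : Fin r × Fin r => p.1 ≠ p.2) = (univ : Finset (Fin r)).offDiag := by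
      ext p; simp [mem_offDiag]
    rw [this, offDiag_card, card_univ, Fintype.card_fin, Nat.mul_sub, mul_one]
  rw [Fintype.card_prod, h, Fintype.card_fin]

lemma card_col_le (a : Fin r) (B : Finset (Fin k)) :
    (univ.filter fun s : State r k => s.col = a ∧ s.2 ∈ B).card ≤ (r - 1) * B.card := by
  have : ((univ.erase a) ×ˢ B).card = (r - 1) * B.card := by
    rw [card_product, card_erase_of_mem (mem_univ a), card_univ, Fintype.card_fin]
  rw [← this]
  refine Finset.card_le_card_of_injOn (fun s => (s.alt, s.2)) ?_ ?_
  · intro s hs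
    simp only [coe_filter, mem_univ, true_and, Set.mem_ofPred_eq] at hs
    simp only [coe_product, Set.mem_prod, mem_coe, mem_erase, mem_univ, and_true]
    exact ⟨fun h => s.col_ne_alt (hs.1.trans h.symm), hs.2⟩
  · intro s hs s' hs' h
    simp only [coe_filter, mem_univ, true_and, Set.mem_ofPred_eq] at hs hs'
    simp only [Prod.mk.injEq] at h
    exact Prod.ext (Subtype.ext (Prod.ext (hs.1.trans hs'.1.symm) h.1)) h.2

lemma card_alt_le (a : Fin r) (B : Finset (Fin k)) :
    (univ.filter fun s : State r k => s.alt = a ∧ s.2 ∈ B).card ≤ (r - 1) * B.card := by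
  have : ((univ.erase a) ×ˢ B).card = (r - 1) * B.card := by
    rw [card_product, card_erase_of_mem (mem_univ a), card_univ, Fintype.card_fin]
  rw [← this]
  refine Finset.card_le_card_of_injOn (fun s => (s.col, s.2)) ?_ ?_
  · intro s hs
    simp only [coe_filter, mem_univ, true_and, Set.mem_ofPred_eq] at hs
    simp only [coe_product, Set.mem_prod, mem_coe, mem_erase, mem_univ, and_true]
    exact ⟨fun h => s.col_ne_alt (h.trans hs.1.symm), hs.2⟩
  · intro s hs s' hs' h
    simp only [coe_filter, mem_univ, true_and, Set.mem_ofPred_eq] at hs hs'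
    simp only [Prod.mk.injEq] at h
    exact Prod.ext (Subtype.ext (Prod.ext h.1 (hs.1.trans hs'.1.symm))) h.2

lemma card_col_alt_le (a b : Fin r) (B : Finset (Fin k)) :
    (univ.filter fun s : State r k => s.col = b ∧ s.alt = a ∧ s.2 ∈ B).card ≤ B.card := by
  refine Finset.card_le_card_of_injOn (fun s => s.2) ?_ ?_
  · intro s hs
    simp only [coe_filter, mem_univ, true_and, Set.mem_ofPred_eq] at hs
    exact hs.2.2
  · intro s hs s' hs' h
    simp only [coe_filter, mem_univ, true_and, Set.mem_ofPred_eq] at hs hs'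
    exact Prod.ext (Subtype.ext (Prod.ext (hs.1.trans hs'.1.symm) (hs.2.1.trans hs'.2.1.symm))) h

lemma card_filter_lt {J : ℕ} (hJ : J ≤ k) :
    (univ.filter fun b : Fin k => (b : ℕ) < J).card = J := by
  rw [Fin.card_filter_val_lt, min_eq_right hJ]

lemma card_filter_not_lt {J : ℕ} (hJ : J ≤ k) :
    (univ.filter fun b : Fin k => ¬ (b : ℕ) < J).card = k - J := by
  have := Finset.card_filter_add_card_filter_not (s := (univ : Finset (Fin k)))
    (fun b : Fin k => (b : ℕ) < J)
  rw [card_filter_lt hJ, card_univ, Fintype.card_fin] at this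
  omega

lemma cast_card_state (hr : 2 ≤ r) :
    (Fintype.card (State r k) : ℝ) = r * (r - 1) * k := by
  rw [card_state]
  push_cast [Nat.cast_sub (show 1 ≤ r by omega)]
  ring

lemma prob_col (hr : 2 ≤ r) (a : Fin r) :
    ((univ.filter fun s : State r k => s.col = a).card : ℝ) ≤
      (r : ℝ)⁻¹ * Fintype.card (State r k) := by
  have h := card_col_le (k := k) a univ
  simp only [mem_univ, and_true, card_univ, Fintype.card_fin] at h
  have h' : ((univ.filter fun s : State r k => s.col = a).card : ℝ) ≤ (r - 1) * k := by
    calc _ ≤ (((r - 1) * k : ℕ) : ℝ) := by exact_mod_cast h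
      _ = _ := by push_cast [Nat.cast_sub (show 1 ≤ r by omega)]; ring
  have hr0 : (r : ℝ) ≠ 0 := by positivity
  rw [cast_card_state hr, mul_assoc, inv_mul_cancel_left₀ hr0]
  exact h'

lemma prob_col_not_free (hr : 2 ≤ r) (hk : 0 < k) {J : ℕ} (hJ : J ≤ k) (a : Fin r) :
    ((univ.filter fun s : State r k => s.col = a ∧ ¬ s.Free J).card : ℝ) ≤
      ((1 - J / k) * (r : ℝ)⁻¹) * Fintype.card (State r k) := by
  have h := card_col_le (k := k) a (univ.filter fun b : Fin k => ¬ (b : ℕ) < J)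
  rw [card_filter_not_lt hJ] at h
  have h' : ((univ.filter fun s : State r k => s.col = a ∧ ¬ s.Free J).card : ℝ) ≤
      (r - 1) * (k - J) := by
    calc _ ≤ (((r - 1) * (k - J) : ℕ) : ℝ) := Nat.cast_le.2 ((card_le_card fun s hs => by
          rw [mem_filter] at hs ⊢
          exact ⟨hs.1, hs.2.1, by simpa [State.Free] using hs.2.2⟩).trans h)
      _ = _ := by push_cast [Nat.cast_sub (show 1 ≤ r by omega), Nat.cast_sub hJ]; ring
  have hk0 : (k : ℝ) ≠ 0 := by positivity
  have hr0 : (r : ℝ) ≠ 0 := by positivity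
  rw [cast_card_state hr]
  convert h' using 1
  field_simp

lemma prob_alt_free (hr : 2 ≤ r) (hk : 0 < k) {J : ℕ} (hJ : J ≤ k) (a : Fin r) :
    ((univ.filter fun s : State r k => s.alt = a ∧ s.Free J).card : ℝ) ≤
      (J / k * (r : ℝ)⁻¹) * Fintype.card (State r k) := by
  have h := card_alt_le (k := k) a (univ.filter fun b : Fin k => (b : ℕ) < J)
  rw [card_filter_lt hJ] at h
  have h' : ((univ.filter fun s : State r k => s.alt = a ∧ s.Free J).card : ℝ) ≤
      (r - 1) * J := by
    calc _ ≤ (((r - 1) * J : ℕ) : ℝ) := Nat.cast_le.2 ((card_le_card fun s hs => by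
          rw [mem_filter] at hs ⊢
          exact ⟨hs.1, hs.2.1, by simpa [State.Free] using hs.2.2⟩).trans h)
      _ = _ := by push_cast [Nat.cast_sub (show 1 ≤ r by omega)]; ring
  have hk0 : (k : ℝ) ≠ 0 := by positivity
  have hr0 : (r : ℝ) ≠ 0 := by positivity
  rw [cast_card_state hr]
  convert h' using 1
  field_simp

lemma prob_col_alt_free (hr : 2 ≤ r) (hk : 0 < k) {J : ℕ} (hJ : J ≤ k) (a b : Fin r) :
    ((univ.filter fun s : State r k => s.col = b ∧ s.alt = a ∧ s.Free J).card : ℝ) ≤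
      (J / k * ((r : ℝ)⁻¹ * (r - 1 : ℝ)⁻¹)) * Fintype.card (State r k) := by
  have h := card_col_alt_le (k := k) a b (univ.filter fun b : Fin k => (b : ℕ) < J)
  rw [card_filter_lt hJ] at h
  have h' : ((univ.filter fun s : State r k => s.col = b ∧ s.alt = a ∧ s.Free J).card : ℝ) ≤ J :=
    Nat.cast_le.2 ((card_le_card fun s hs => by
      rw [mem_filter] at hs ⊢
      exact ⟨hs.1, hs.2.1, hs.2.2.1, by simpa [State.Free] using hs.2.2.2⟩).trans h)
  have hk0 : (k : ℝ) ≠ 0 := by positivity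
  have hr0 : (r : ℝ) ≠ 0 := by positivity
  have hr1 : (r : ℝ) - 1 ≠ 0 := by
    have : (2 : ℝ) ≤ r := by exact_mod_cast hr
    linarith
  rw [cast_card_state hr]
  convert h' using 1
  field_simp

lemma prob_col_or_alt_free (hr : 2 ≤ r) (hk : 0 < k) {J : ℕ} (hJ : J ≤ k) (a : Fin r) :
    ((univ.filter fun s : State r k => s.col = a ∨ (s.alt = a ∧ s.Free J)).card : ℝ) ≤
      ((1 + J / k) * (r : ℝ)⁻¹) * Fintype.card (State r k) := by
  have h1 := prob_col (k := k) hr a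
  have h2 := prob_alt_free hr hk hJ a
  rw [filter_or]
  have h3 : ((univ.filter (fun s : State r k => s.col = a) ∪
      univ.filter (fun s : State r k => s.alt = a ∧ s.Free J)).card : ℝ) ≤
      (univ.filter fun s : State r k => s.col = a).card +
        (univ.filter fun s : State r k => s.alt = a ∧ s.Free J).card := by
    exact_mod_cast card_union_le _ _
  linarith

end States

section Events

variable {V : Type*} [DecidableEq V] {r k : ℕ}

/-- The edge `e` becomes monochromatic of color `α` after recoloring exactly the vertices of `A`,
and no further vertex of `e` may be recolored. -/
def StuckEvent (J : ℕ) (e : Finset V) (α : Fin r) (A : Finset V) (ω : V → State r k) : Prop :=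
  ∀ u ∈ e, (u ∈ A → (ω u).alt = α ∧ (ω u).Free J) ∧ (u ∉ A → (ω u).col = α ∧ ¬ (ω u).Free J)

lemma card_stuckEvent_le (hr : 2 ≤ r) (hk : 0 < k) {J : ℕ} (hJ : J ≤ k) {e : Finset V}
    (α : Fin r) {A : Finset V} (hA : A ⊆ e) (G : Finset (V → State r k)) (hG : UpdateClosed G e)
    [Nonempty (State r k)] :
    ((G.filter (StuckEvent J e α A)).card : ℝ) ≤
      ((r : ℝ)⁻¹ ^ e.card * ((J / k : ℝ) ^ A.card * (1 - J / k : ℝ) ^ (e.card - A.card))) *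
        G.card := by
  have h := card_le_of_forall e
    (fun (_ : V → State r k) u s => (u ∈ A → s.alt = α ∧ s.Free J) ∧
      (u ∉ A → s.col = α ∧ ¬ s.Free J))
    (fun u => if u ∈ A then J / k * (r : ℝ)⁻¹ else (1 - J / k) * (r : ℝ)⁻¹)
    (fun _ _ _ _ _ _ _ => Iff.rfl) ?_ G hG (G.filter (StuckEvent J e α A)) (filter_subset _ _)
    fun ω hω => (mem_filter.1 hω).2
  · refine h.trans (le_of_eq ?_)
    congr 1
    rw [prod_ite, prod_const, prod_const, filter_mem_eq_inter, inter_eq_right.2 hA,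
      filter_notMem_eq_sdiff, card_sdiff_of_subset hA, mul_pow, mul_pow]
    have : e.card = A.card + (e.card - A.card) := by have := card_le_card hA; omega
    conv_rhs => rw [this, pow_add, ← this]
    ring
  · intro u _ ω
    split_ifs with hu
    · exact ⟨_, fun s hs => mem_filter.2 ⟨mem_univ s, hs.1 hu⟩, prob_alt_free hr hk hJ α⟩
    · exact ⟨_, fun s hs => mem_filter.2 ⟨mem_univ s, hs.2 hu⟩, prob_col_not_free hr hk hJ α⟩

/-- The edge `e` has only vertices of initial color `α` and vertices that may be recolored to `α`,
and each `f i` is an edge meeting `e` in vertices that may be recolored to `α`, that becomes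
monochromatic, in the initial color of `v i`, after recoloring the vertices of `A i`. -/
def ChainEvent (J : ℕ) {x : ℕ} (e : Finset V) (α : Fin r) (v : Fin x → V)
    (f A : Fin x → Finset V) (ω : V → State r k) : Prop :=
  (∀ u ∈ e, (ω u).col = α ∨ ((ω u).alt = α ∧ (ω u).Free J)) ∧
  (∀ i, ∀ u ∈ f i, u ∈ e → (ω u).col = (ω (v i)).col ∧ (ω u).alt = α ∧ (ω u).Free J) ∧
  ∀ i, ∀ u ∈ f i, u ∉ e → (u ∈ A i → (ω u).alt = (ω (v i)).col ∧ (ω u).Free J) ∧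
    (u ∉ A i → (ω u).col = (ω (v i)).col)

/-- The combinatorial conditions on the edges of a `ChainEvent`. -/
structure IsChain (k : ℕ) {x : ℕ} (e : Finset V) (v : Fin x → V) (f A : Fin x → Finset V) :
    Prop where
  card_e : e.card = k
  card_f : ∀ i, (f i).card = k
  mem_e : ∀ i, v i ∈ e
  mem_f : ∀ i, v i ∈ f i
  notMem_f : ∀ i j, i ≠ j → v j ∉ f i
  inter_le : ∀ i, (f i ∩ e).card ≤ 2
  disj : ∀ i j, i ≠ j → Disjoint (f i \ e) (f j \ e)
  sub : ∀ i, A i ⊆ f i \ e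

section Chain

variable {J x : ℕ} {e : Finset V} {α : Fin r} {v : Fin x → V} {f A : Fin x → Finset V}

lemma IsChain.injective (hc : IsChain k e v f A) : Function.Injective v := by
  intro i j hij
  by_contra hne
  exact hc.notMem_f i j hne (hij ▸ hc.mem_f i)

lemma IsChain.image_subset (hc : IsChain k e v f A) : univ.image v ⊆ e := by
  intro u hu
  obtain ⟨i, -, rfl⟩ := mem_image.1 hu
  exact hc.mem_e i

lemma card_le_of_col_or_alt_free (hr : 2 ≤ r) (hk : 0 < k) (hJ : J ≤ k) [Nonempty (State r k)]
    {D : Finset V} {G H : Finset (V → State r k)} (hG : UpdateClosed G D) (hHG : H ⊆ G)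
    (hH : ∀ ω ∈ H, ∀ u ∈ D, (ω u).col = α ∨ ((ω u).alt = α ∧ (ω u).Free J)) :
    (H.card : ℝ) ≤ ((1 + J / k) * (r : ℝ)⁻¹) ^ D.card * G.card := by
  have := card_le_of_forall D (fun _ _ s => s.col = α ∨ (s.alt = α ∧ s.Free J))
      (fun _ => (1 + J / k) * (r : ℝ)⁻¹)
      (fun _ _ _ _ _ _ _ => Iff.rfl) (fun u _ ω => by
        refine ⟨_, ?_, prob_col_or_alt_free hr hk hJ α⟩
        exact fun s hs => mem_filter.2 ⟨mem_univ s, hs⟩)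
      G hG H hHG hH
  rwa [prod_const] at this

/-- The vertex `v i` is not the only common vertex of `f i` and `e`. -/
def Meets (e : Finset V) (v : Fin x → V) (f : Fin x → Finset V) (i : Fin x) : Prop :=
  ∃ z ∈ f i, z ∈ e ∧ z ≠ v i

lemma card_le_of_alt_free (hr : 2 ≤ r) (hk : 0 < k) (hJ : J ≤ k) [Nonempty (State r k)]
    (hc : IsChain k e v f A) {G H : Finset (V → State r k)}
    (hG : UpdateClosed G (univ.image v)) (hHG : H ⊆ G)
    (hH : ∀ ω ∈ H, ∀ i, ∀ u ∈ f i, u ∈ e →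
      (ω u).col = (ω (v i)).col ∧ (ω u).alt = α ∧ (ω u).Free J) :
    (H.card : ℝ) ≤ (∏ i, if Meets e v f i then (J / k : ℝ) * ((r : ℝ)⁻¹ * (r - 1 : ℝ)⁻¹) else
      (J / k : ℝ) * (r : ℝ)⁻¹) * G.card := by
  have hz : ∀ i, ∀ z ∈ f i, z ≠ v i → z ∉ univ.image v := by
    intro i z hz hne hzI
    obtain ⟨j, -, rfl⟩ := mem_image.1 hzI
    exact hc.notMem_f i j (fun h => hne (h ▸ rfl)) hz
  have key := card_le_of_forall (univ.image v)
    (fun (ω : V → State r k) u s => s.alt = α ∧ s.Free J ∧ ∀ i, v i = u → ∀ z ∈ f i, z ∈ e →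
      z ≠ v i → s.col = (ω z).col)
    (fun u => if ∃ i, v i = u ∧ Meets e v f i then (J / k : ℝ) * ((r : ℝ)⁻¹ * (r - 1 : ℝ)⁻¹) else
      (J / k : ℝ) * (r : ℝ)⁻¹) ?_ ?_ G hG H hHG ?_
  · rw [prod_image fun i _ j _ h => hc.injective h] at key
    refine key.trans (le_of_eq ?_)
    congr 1
    refine prod_congr rfl fun i _ => ?_
    have : (∃ j, v j = v i ∧ Meets e v f j) ↔ Meets e v f i :=
      ⟨fun ⟨j, hj, h⟩ => hc.injective hj ▸ h, fun h => ⟨i, rfl, h⟩⟩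
    simp only [this]
  · intro ω u hu s w hw y
    refine and_congr_right fun _ => and_congr_right fun _ => forall_congr' fun i =>
      forall_congr' fun hi => forall_congr' fun z => forall_congr' fun hzf =>
      forall_congr' fun _ => forall_congr' fun hzv => ?_
    have hzu : z ≠ u := by
      rintro rfl
      exact hz i z hzf hzv hu
    rw [Function.update_of_ne hzu]
  · intro u _ ω
    split_ifs with h
    · obtain ⟨i, hi, z, hzf, hze, hzv⟩ := h
      exact ⟨_, fun s hs => mem_filter.2 ⟨mem_univ s, hs.2.2 i hi z hzf hze hzv, hs.1, hs.2.1⟩,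
        prob_col_alt_free hr hk hJ α (ω z).col⟩
    · exact ⟨_, fun s hs => mem_filter.2 ⟨mem_univ s, hs.1, hs.2.1⟩,
        prob_alt_free hr hk hJ α⟩
  · intro ω hω u hu
    obtain ⟨i, -, rfl⟩ := mem_image.1 hu
    have h3 := hH ω hω i (v i) (hc.mem_f i) (hc.mem_e i)
    refine ⟨h3.2.1, h3.2.2, fun j hj z hz hze _ => ?_⟩
    rw [← hj]
    exact (hH ω hω j z hz hze).1.symm

lemma card_le_of_recolored (hr : 2 ≤ r) (hk : 0 < k) (hJ : J ≤ k) [Nonempty (State r k)]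
    (hc : IsChain k e v f A) {G H : Finset (V → State r k)}
    (hG : UpdateClosed G (univ.biUnion fun i => f i \ e)) (hHG : H ⊆ G)
    (hH : ∀ ω ∈ H, ∀ i, ∀ u ∈ f i, u ∉ e →
      (u ∈ A i → (ω u).alt = (ω (v i)).col ∧ (ω u).Free J) ∧
      (u ∉ A i → (ω u).col = (ω (v i)).col)) :
    (H.card : ℝ) ≤ (∏ i, ((r : ℝ)⁻¹ ^ (f i \ e).card * (J / k : ℝ) ^ (A i).card)) * G.card := by
  have hDe : ∀ u ∈ univ.biUnion fun i => f i \ e, u ∉ e := by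
    intro u hu
    obtain ⟨i, -, hi⟩ := mem_biUnion.1 hu
    exact (Finset.mem_sdiff.1 hi).2
  have key := card_le_of_forall (univ.biUnion fun i => f i \ e)
    (fun (ω : V → State r k) u s => ∀ i, u ∈ f i →
      (u ∈ A i → s.alt = (ω (v i)).col ∧ s.Free J) ∧ (u ∉ A i → s.col = (ω (v i)).col))
    (fun u => if ∃ i, u ∈ A i then J / k * (r : ℝ)⁻¹ else (r : ℝ)⁻¹) ?_ ?_ G hG H hHG
    fun ω hω u hu i hi => hH ω hω i u hi (hDe u hu)
  · refine key.trans (le_of_eq ?_)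
    congr 1
    rw [prod_biUnion fun i _ j _ hij => hc.disj i j hij]
    refine prod_congr rfl fun i _ => ?_
    have : ∀ u ∈ f i \ e, (if ∃ i, u ∈ A i then J / k * (r : ℝ)⁻¹ else (r : ℝ)⁻¹) =
        (r : ℝ)⁻¹ * (if u ∈ A i then (J / k : ℝ) else 1) := by
      intro u hu
      have hiff : (∃ j, u ∈ A j) ↔ u ∈ A i := by
        refine ⟨fun ⟨j, hj⟩ => ?_, fun h => ⟨i, h⟩⟩
        by_contra hcon
        have hij : i ≠ j := fun h => hcon (h ▸ hj)
        exact (Finset.disjoint_left.1 (hc.disj i j hij)) hu (hc.sub j hj)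
      simp only [hiff]
      split_ifs <;> ring
    rw [prod_congr rfl this, prod_mul_distrib, prod_const, prod_ite_mem,
      inter_eq_right.2 (hc.sub i), prod_const]
  · intro ω u hu s w hw y
    have : ∀ i, v i ≠ u := fun i hi => hDe u hu (hi ▸ hc.mem_e i)
    simp only [ne_eq, this, not_false_eq_true, Function.update_of_ne]
  · intro u hu ω
    split_ifs with h
    · obtain ⟨i, hi⟩ := h
      have hui : u ∈ f i := (Finset.mem_sdiff.1 (hc.sub i hi)).1
      exact ⟨_, fun s hs => mem_filter.2 ⟨mem_univ s, (hs i hui).1 hi⟩,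
        prob_alt_free hr hk hJ (ω (v i)).col⟩
    · obtain ⟨i, -, hi⟩ := mem_biUnion.1 hu
      have hui : u ∈ f i := (Finset.mem_sdiff.1 hi).1
      exact ⟨_, fun s hs => mem_filter.2 ⟨mem_univ s, (hs i hui).2 fun h' => h ⟨i, h'⟩⟩,
        prob_col hr (ω (v i)).col⟩

lemma IsChain.prob_le (hr : 2 ≤ r) (hk : 2 ≤ k) (hc : IsChain k e v f A) (i : Fin x) {p : ℝ}
    (hp0 : 0 ≤ p) :
    (if Meets e v f i then p * ((r : ℝ)⁻¹ * (r - 1 : ℝ)⁻¹) else p * (r : ℝ)⁻¹) *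
      ((r : ℝ)⁻¹ ^ (f i \ e).card * p ^ (A i).card) ≤
      (r : ℝ)⁻¹ * (2 * p * (r : ℝ)⁻¹ ^ (k - 1) * p ^ (A i).card) := by
  have hr2 : (2 : ℝ) ≤ r := by exact_mod_cast hr
  have hcard : (f i \ e).card + (f i ∩ e).card = k := by
    rw [card_sdiff_add_card_inter, hc.card_f i]
  have hle := hc.inter_le i
  have hvi : v i ∈ f i ∩ e := mem_inter.2 ⟨hc.mem_f i, hc.mem_e i⟩
  have hρ0 : 0 < (r : ℝ)⁻¹ := by positivity
  have hρ1 : (r : ℝ)⁻¹ ≤ 1 := inv_le_one_of_one_le₀ (by linarith)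
  have h4 : (r - 1 : ℝ)⁻¹ ≤ 2 * (r : ℝ)⁻¹ := by
    rw [← div_eq_mul_inv, inv_le_comm₀ (by linarith) (by positivity), inv_div,
      div_le_iff₀ (by norm_num)]
    linarith
  generalize (r : ℝ)⁻¹ = ρ at *
  have hpA : 0 ≤ p ^ (A i).card := by positivity
  split_ifs with h
  · have h2 : ρ ^ (f i \ e).card ≤ ρ ^ (k - 2) :=
      pow_le_pow_of_le_one hρ0.le hρ1 (by omega)
    have h3 : ρ ^ (k - 1) = ρ ^ (k - 2) * ρ := by
      rw [← pow_succ]; congr 1; omega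
    rw [h3]
    calc p * (ρ * (r - 1 : ℝ)⁻¹) * (ρ ^ (f i \ e).card * p ^ (A i).card)
        ≤ p * (ρ * (2 * ρ)) * (ρ ^ (k - 2) * p ^ (A i).card) := by gcongr
      _ = _ := by ring
  · have h1 : f i ∩ e = {v i} := by
      refine eq_singleton_iff_unique_mem.2 ⟨hvi, fun z hz => ?_⟩
      by_contra hne
      rw [mem_inter] at hz
      exact h ⟨z, hz.1, hz.2, hne⟩
    rw [h1, card_singleton] at hcard
    have h2 : (f i \ e).card = k - 1 := by omega
    rw [h2]
    have : 0 ≤ p * ρ * (ρ ^ (k - 1) * p ^ (A i).card) := by positivity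
    linarith

lemma IsChain.prod_le (hr : 2 ≤ r) (hk : 2 ≤ k) (hc : IsChain k e v f A) {p : ℝ} (hp0 : 0 ≤ p) :
    (∏ i, ((r : ℝ)⁻¹ ^ (f i \ e).card * p ^ (A i).card)) *
      ((∏ i, if Meets e v f i then p * ((r : ℝ)⁻¹ * (r - 1 : ℝ)⁻¹) else p * (r : ℝ)⁻¹) *
        ((1 + p) * (r : ℝ)⁻¹) ^ (e \ univ.image v).card) ≤
      (r : ℝ)⁻¹ ^ k * (1 + p) ^ k *
        ∏ i, (2 * p * (r : ℝ)⁻¹ ^ (k - 1) * p ^ (A i).card) := by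
  have hr2 : (2 : ℝ) ≤ r := by exact_mod_cast hr
  have hr1 : (0 : ℝ) ≤ (r - 1 : ℝ)⁻¹ := inv_nonneg.2 (by linarith)
  have hcardI : (univ.image v).card = x := by
    rw [card_image_of_injective _ hc.injective, card_univ, Fintype.card_fin]
  have hxk : x ≤ k := by rw [← hcardI, ← hc.card_e]; exact card_le_card hc.image_subset
  have hρ0 : 0 < (r : ℝ)⁻¹ := by positivity
  have hcomb := fun i => hc.prob_le hr hk i hp0
  rw [card_sdiff_of_subset hc.image_subset, hc.card_e, hcardI, ← mul_assoc,
    mul_comm (∏ i, ((r : ℝ)⁻¹ ^ (f i \ e).card * p ^ (A i).card)), ← prod_mul_distrib]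
  generalize (r : ℝ)⁻¹ = ρ at *
  have h0 : 0 ≤ ∏ i, (2 * p * ρ ^ (k - 1) * p ^ (A i).card) :=
    prod_nonneg fun i _ => by positivity
  calc _ ≤ (∏ i, ρ * (2 * p * ρ ^ (k - 1) * p ^ (A i).card)) * ((1 + p) * ρ) ^ (k - x) := by
        refine mul_le_mul_of_nonneg_right ?_ (by positivity)
        refine Finset.prod_le_prod (fun i _ => ?_) fun i _ => hcomb i
        split_ifs <;> positivity
    _ = (1 + p) ^ (k - x) * ρ ^ k * (∏ i, (2 * p * ρ ^ (k - 1) * p ^ (A i).card)) := by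
        rw [prod_mul_distrib (f := fun _ => ρ), prod_const, card_univ, Fintype.card_fin, mul_pow]
        have : ρ ^ k = ρ ^ (k - x) * ρ ^ x := by rw [← pow_add]; congr 1; omega
        rw [this]
        ring
    _ ≤ (1 + p) ^ k * ρ ^ k * (∏ i, (2 * p * ρ ^ (k - 1) * p ^ (A i).card)) := by
        have h1 : (1 + p) ^ (k - x) ≤ (1 + p) ^ k :=
          pow_le_pow_right₀ (by linarith) (Nat.sub_le k x)
        gcongr
    _ = _ := by ring

lemma card_chainEvent_le (hr : 2 ≤ r) (hk : 2 ≤ k) (hJ : J ≤ k) (hc : IsChain k e v f A)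
    (G : Finset (V → State r k)) (hG : UpdateClosed G (e ∪ univ.biUnion f))
    [Nonempty (State r k)] :
    ((G.filter (ChainEvent J e α v f A)).card : ℝ) ≤
      ((r : ℝ)⁻¹ ^ k * (1 + J / k : ℝ) ^ k *
        ∏ i, (2 * (J / k : ℝ) * (r : ℝ)⁻¹ ^ (k - 1) * (J / k : ℝ) ^ (A i).card)) * G.card := by
  have hr2 : (2 : ℝ) ≤ r := by exact_mod_cast hr
  have hr1 : (0 : ℝ) ≤ (r - 1 : ℝ)⁻¹ := inv_nonneg.2 (by linarith)
  have hDe : ∀ u ∈ univ.biUnion fun i => f i \ e, u ∉ e := by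
    intro u hu
    obtain ⟨i, -, hi⟩ := mem_biUnion.1 hu
    exact (Finset.mem_sdiff.1 hi).2
  have hD : (univ.biUnion fun i => f i \ e) ⊆ e ∪ univ.biUnion f := by
    intro u hu
    obtain ⟨i, -, hi⟩ := mem_biUnion.1 hu
    exact mem_union_right _ (mem_biUnion.2 ⟨i, mem_univ i, (Finset.mem_sdiff.1 hi).1⟩)
  obtain ⟨G₁, hG₁⟩ : ∃ G₁ : Finset (V → State r k), ∀ ω, ω ∈ G₁ ↔ ω ∈ G ∧
      ∀ u ∈ e \ univ.image v, (ω u).col = α ∨ ((ω u).alt = α ∧ (ω u).Free J) :=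
    ⟨_, fun ω => mem_filter⟩
  obtain ⟨G₂, hG₂⟩ : ∃ G₂ : Finset (V → State r k), ∀ ω, ω ∈ G₂ ↔ ω ∈ G₁ ∧
      ∀ i, ∀ u ∈ f i, u ∈ e → (ω u).col = (ω (v i)).col ∧ (ω u).alt = α ∧ (ω u).Free J :=
    ⟨_, fun ω => mem_filter⟩
  have hcl₁ : UpdateClosed G₁ (univ.image v ∪ univ.biUnion fun i => f i \ e) := by
    intro ω hω u hu s
    rw [hG₁] at hω ⊢
    refine ⟨hG ω hω.1 u (union_subset (hc.image_subset.trans subset_union_left) hD hu) s, ?_⟩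
    intro w hw
    have hwu : w ≠ u := by
      rintro rfl
      rw [Finset.mem_sdiff] at hw
      rcases mem_union.1 hu with h' | h'
      · exact hw.2 h'
      · exact hDe w h' hw.1
    rw [Function.update_of_ne hwu]
    exact hω.2 w hw
  have hcl₂ : UpdateClosed G₂ (univ.biUnion fun i => f i \ e) := by
    intro ω hω u hu s
    rw [hG₂] at hω ⊢
    refine ⟨hcl₁ ω hω.1 u (mem_union_right _ hu) s, fun i w hw hwe => ?_⟩
    have hne : ∀ y ∈ e, y ≠ u := fun y hy hyu => hDe u hu (hyu ▸ hy)
    rw [Function.update_of_ne (hne w hwe), Function.update_of_ne (hne _ (hc.mem_e i))]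
    exact hω.2 i w hw hwe
  have b₁ := card_le_of_col_or_alt_free (α := α) hr (by omega) hJ
    (hG.mono (sdiff_subset.trans subset_union_left)) (fun ω hω => ((hG₁ ω).1 hω).1)
    fun ω hω => ((hG₁ ω).1 hω).2
  have b₂ := card_le_of_alt_free (α := α) hr (by omega) hJ hc (hcl₁.mono subset_union_left)
    (fun ω hω => ((hG₂ ω).1 hω).1) fun ω hω => ((hG₂ ω).1 hω).2
  have b₃ := card_le_of_recolored (H := G.filter (ChainEvent J e α v f A)) hr (by omega) hJ hc hcl₂
    (fun ω hω => by
      obtain ⟨hω, he, h1, -⟩ := mem_filter.1 hω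
      exact (hG₂ ω).2 ⟨(hG₁ ω).2 ⟨hω, fun u hu => he u (Finset.mem_sdiff.1 hu).1⟩, h1⟩)
    fun ω hω => (mem_filter.1 hω).2.2.2
  refine b₃.trans ((mul_le_mul_of_nonneg_left (b₂.trans (mul_le_mul_of_nonneg_left b₁ ?_))
    ?_).trans ?_)
  · refine prod_nonneg fun i _ => ?_
    split_ifs <;> positivity
  · exact prod_nonneg fun i _ => by positivity
  · rw [← mul_assoc, ← mul_assoc, mul_assoc (∏ i, _)]
    refine mul_le_mul_of_nonneg_right (hc.prod_le hr hk (by positivity)) (Nat.cast_nonneg _)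

end Chain

end Events

section Recoloring

variable {V : Type*} [DecidableEq V] {r k : ℕ}

/-- The coloring obtained from the initial coloring by recoloring the vertices of `R`. -/
def recolor (ω : V → State r k) (R : Finset V) (u : V) : Fin r :=
  if u ∈ R then (ω u).alt else (ω u).col

/-- A record of a recoloring process: the vertices of `R` have been recolored in the order given
by `τ`, the vertex `v` on account of the edge `f v`, which was monochromatic at that moment and had
at most `T` recolored vertices. -/
structure IsProcess (E : Finset (Finset V)) (J T : ℕ) (ω : V → State r k) (R : Finset V)
    (f : V → Finset V) (τ : V → ℕ) : Prop where
  inj : ∀ v ∈ R, ∀ w ∈ R, τ v = τ w → v = w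
  free : ∀ v ∈ R, (ω v).Free J
  edge : ∀ v ∈ R, f v ∈ E
  mem : ∀ v ∈ R, v ∈ f v
  card_le : ∀ v ∈ R, ((f v).filter fun u => u ∈ R ∧ τ u < τ v).card ≤ T
  alt_eq : ∀ v ∈ R, ∀ u ∈ f v, u ∈ R → τ u < τ v → (ω u).alt = (ω v).col
  col_eq : ∀ v ∈ R, ∀ u ∈ f v, ¬ (u ∈ R ∧ τ u < τ v) → (ω u).col = (ω v).col

variable {E : Finset (Finset V)} {J T : ℕ} {ω : V → State r k} {R : Finset V} {f : V → Finset V}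
  {τ : V → ℕ}

lemma IsProcess.subset (h : IsProcess E J T ω R f τ) : R ⊆ E.biUnion id :=
  fun v hv => mem_biUnion.2 ⟨f v, h.edge v hv, h.mem v hv⟩

lemma IsProcess.extend (h : IsProcess E J T ω R f τ) {e : Finset V} (he : e ∈ E) {α : Fin r}
    (hα : ∀ u ∈ e, recolor ω R u = α) (hT : (e ∩ R).card ≤ T) {w : V} (hwe : w ∈ e) (hwR : w ∉ R)
    (hw : (ω w).Free J) :
    IsProcess E J T ω (insert w R) (Function.update f w e)
      (Function.update τ w (R.sup τ + 1)) := by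
  have hτ : ∀ u ∈ R, Function.update τ w (R.sup τ + 1) u = τ u := fun u hu =>
    Function.update_of_ne (by rintro rfl; exact hwR hu) _ _
  have hf : ∀ u ∈ R, Function.update f w e u = f u := fun u hu =>
    Function.update_of_ne (by rintro rfl; exact hwR hu) _ _
  have hlt : ∀ u ∈ R, τ u < R.sup τ + 1 := fun u hu => Nat.lt_succ_of_le (le_sup hu)
  have hcol : (ω w).col = α := by
    have := hα w hwe
    rwa [recolor, if_neg hwR] at this
  have hiff : ∀ v ∈ R, ∀ u, (u ∈ insert w R ∧ Function.update τ w (R.sup τ + 1) u <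
      Function.update τ w (R.sup τ + 1) v) ↔ u ∈ R ∧ τ u < τ v := by
    intro v hv u
    rw [hτ v hv]
    constructor
    · rintro ⟨hu, hlt'⟩
      rcases mem_insert.1 hu with rfl | hu
      · rw [Function.update_self] at hlt'
        exact absurd (hlt'.trans (hlt v hv)) (lt_irrefl _)
      · rw [hτ u hu] at hlt'
        exact ⟨hu, hlt'⟩
    · rintro ⟨hu, hlt'⟩
      rw [hτ u hu]
      exact ⟨mem_insert_of_mem hu, hlt'⟩
  have hiffw : ∀ u, (u ∈ insert w R ∧ Function.update τ w (R.sup τ + 1) u <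
      Function.update τ w (R.sup τ + 1) w) ↔ u ∈ R := by
    intro u
    rw [Function.update_self]
    constructor
    · rintro ⟨hu, hlt'⟩
      rcases mem_insert.1 hu with rfl | hu
      · rw [Function.update_self] at hlt'
        exact absurd hlt' (lt_irrefl _)
      · exact hu
    · intro hu
      rw [hτ u hu]
      exact ⟨mem_insert_of_mem hu, hlt u hu⟩
  refine ⟨?_, ?_, ?_, ?_, ?_, ?_, ?_⟩
  · rw [forall_mem_insert]
    refine ⟨?_, fun v hv => ?_⟩
    · rw [forall_mem_insert]
      refine ⟨fun _ => rfl, fun u hu h' => ?_⟩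
      rw [Function.update_self, hτ u hu] at h'
      exact absurd (hlt u hu) (by omega)
    · rw [forall_mem_insert, hτ v hv]
      refine ⟨fun h' => ?_, fun u hu h' => ?_⟩
      · rw [Function.update_self] at h'
        exact absurd (hlt v hv) (by omega)
      · rw [hτ u hu] at h'
        exact h.inj v hv u hu h'
  · rw [forall_mem_insert]
    exact ⟨hw, h.free⟩
  · rw [forall_mem_insert]
    refine ⟨by rwa [Function.update_self], fun v hv => ?_⟩
    rw [hf v hv]
    exact h.edge v hv
  · rw [forall_mem_insert]
    refine ⟨by rwa [Function.update_self], fun v hv => ?_⟩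
    rw [hf v hv]
    exact h.mem v hv
  · rw [forall_mem_insert]
    refine ⟨(card_le_card fun u hu => ?_).trans hT, fun v hv =>
      (card_le_card fun u hu => ?_).trans (h.card_le v hv)⟩
    · rw [mem_filter, hiffw, Function.update_self] at hu
      exact mem_inter.2 hu
    · rw [mem_filter, hiff v hv, hf v hv] at hu
      exact mem_filter.2 hu
  · rw [forall_mem_insert]
    refine ⟨fun u hu hu' hlt' => ?_, fun v hv u hu hu' hlt' => ?_⟩
    · rw [Function.update_self] at hu
      have huR := (hiffw u).1 ⟨hu', hlt'⟩
      have := hα u hu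
      rw [recolor, if_pos huR] at this
      rw [this, hcol]
    · rw [hf v hv] at hu
      have := (hiff v hv u).1 ⟨hu', hlt'⟩
      exact h.alt_eq v hv u hu this.1 this.2
  · rw [forall_mem_insert]
    refine ⟨fun u hu hn => ?_, fun v hv u hu hn => ?_⟩
    · rw [Function.update_self] at hu
      rw [hiffw] at hn
      have := hα u hu
      rw [recolor, if_neg hn] at this
      rw [this, hcol]
    · rw [hf v hv] at hu
      rw [hiff v hv] at hn
      exact h.col_eq v hv u hu hn

lemma exists_maximal_process (E : Finset (Finset V)) (J T : ℕ) (ω : V → State r k) :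
    ∃ R f τ, IsProcess E J T ω R f τ ∧
      ∀ R' f' τ', IsProcess E J T ω R' f' τ' → R'.card ≤ R.card := by
  have h0 : ∃ n, ∃ R f τ, IsProcess E J T ω R f τ ∧ R.card = n := by
    refine ⟨0, ∅, fun _ => ∅, fun _ => 0, ?_, rfl⟩
    constructor <;> simp
  have hb : ∀ n, (∃ R f τ, IsProcess E J T ω R f τ ∧ R.card = n) →
      n ≤ (E.biUnion id).card := by
    rintro n ⟨R, f, τ, h, rfl⟩
    exact Finset.card_le_card h.subset
  obtain ⟨n, hn⟩ := h0
  obtain ⟨R, f, τ, h, hR⟩ := Nat.findGreatest_spec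
    (P := fun n => ∃ R f τ, IsProcess E J T ω R f τ ∧ R.card = n) (hb n hn) hn
  refine ⟨R, f, τ, h, fun R' f' τ' h' => ?_⟩
  rw [hR]
  exact Nat.le_findGreatest (hb _ ⟨R', f', τ', h', rfl⟩) ⟨R', f', τ', h', rfl⟩

lemma IsProcess.props_of_mem (h : IsProcess E J T ω R f τ) {e : Finset V} {α : Fin r}
    (hα : ∀ u ∈ e, recolor ω R u = α) {v : V} (hv : v ∈ e ∩ R) {u : V} (hu : u ∈ f v)
    (hue : u ∈ e) :
    u ∈ R ∧ ¬ τ u < τ v ∧ (ω u).col = (ω v).col ∧ (ω u).alt = α := by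
  rw [mem_inter] at hv
  have hval : (ω v).alt = α := by
    have := hα v hv.1
    rwa [recolor, if_pos hv.2] at this
  have hne : (ω v).col ≠ α := hval ▸ (ω v).col_ne_alt
  have hu' := hα u hue
  rw [recolor] at hu'
  split_ifs at hu' with huR
  · have hlt : ¬ τ u < τ v := fun hlt =>
      hne ((h.alt_eq v hv.2 u hu huR hlt).symm.trans hu')
    exact ⟨huR, hlt, h.col_eq v hv.2 u hu (fun h' => hlt h'.2), hu'⟩
  · exact absurd ((h.col_eq v hv.2 u hu fun h' => huR h'.1).symm.trans hu') hne

lemma IsProcess.lt_of_mem (h : IsProcess E J T ω R f τ) {e : Finset V} {α : Fin r}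
    (hα : ∀ u ∈ e, recolor ω R u = α) {v : V} (hv : v ∈ e ∩ R) {u : V} (hu : u ∈ f v)
    (hue : u ∈ e) (hne : u ≠ v) : τ v < τ u := by
  obtain ⟨huR, hlt, -⟩ := h.props_of_mem hα hv hu hue
  refine lt_of_le_of_ne (not_lt.1 hlt) fun h' => hne ?_
  exact h.inj u huR v (mem_inter.1 hv).2 h'.symm

/-- A relation that increases `τ` and relates every element to at most one other element has an
independent set containing at least half of the elements. -/
lemma exists_independent (B : Finset V) (τ : V → ℕ) (Q : V → V → Prop)
    (hτ : ∀ v ∈ B, ∀ w ∈ B, Q v w → τ v < τ w)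
    (hQ : ∀ v ∈ B, ∀ w ∈ B, ∀ w' ∈ B, Q v w → Q v w' → w = w') :
    ∃ I ⊆ B, B.card ≤ 2 * I.card ∧ ∀ v ∈ I, ∀ w ∈ I, ¬ Q v w := by
  have key : ∃ c : V → Bool, ∀ v ∈ B, ∀ w ∈ B, Q v w → c v ≠ c w := by
    induction B using Finset.induction_on_min_value τ with
    | empty => exact ⟨fun _ => true, by simp⟩
    | insert a s ha hmin ih =>
      obtain ⟨c, hc⟩ := ih
        (fun v hv w hw => hτ v (mem_insert_of_mem hv) w (mem_insert_of_mem hw))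
        (fun v hv w hw w' hw' => hQ v (mem_insert_of_mem hv) w (mem_insert_of_mem hw) w'
          (mem_insert_of_mem hw'))
      have hself : ¬ Q a a := fun h' =>
        lt_irrefl _ (hτ a (mem_insert_self a s) a (mem_insert_self a s) h')
      have hin : ∀ v ∈ s, ¬ Q v a := fun v hv h' =>
        absurd (hτ v (mem_insert_of_mem hv) a (mem_insert_self a s) h') (not_lt.2 (hmin v hv))
      have hne : ∀ v ∈ s, v ≠ a := fun v hv h' => ha (h' ▸ hv)
      obtain ⟨b, hb⟩ : ∃ b : Bool, ∀ w ∈ s, Q a w → b ≠ c w := by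
        by_cases hex : ∃ w ∈ s, Q a w
        · obtain ⟨w, hw, haw⟩ := hex
          refine ⟨!c w, fun w' hw' haw' => ?_⟩
          rw [hQ a (mem_insert_self a s) w' (mem_insert_of_mem hw') w (mem_insert_of_mem hw)
            haw' haw]
          simp
        · exact ⟨true, fun w hw haw => absurd ⟨w, hw, haw⟩ hex⟩
      refine ⟨Function.update c a b, ?_⟩
      rw [forall_mem_insert]
      refine ⟨?_, fun v hv => ?_⟩
      · rw [forall_mem_insert]
        refine ⟨fun h' => absurd h' hself, fun w hw haw => ?_⟩
        rw [Function.update_self, Function.update_of_ne (hne w hw)]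
        exact hb w hw haw
      · rw [forall_mem_insert]
        refine ⟨fun h' => absurd h' (hin v hv), fun w hw hvw => ?_⟩
        rw [Function.update_of_ne (hne v hv), Function.update_of_ne (hne w hw)]
        exact hc v hv w hw hvw
  obtain ⟨c, hc⟩ := key
  have hsum := Finset.card_filter_add_card_filter_not (s := B) (fun v => c v = true)
  rcases le_total (B.filter fun v => ¬ c v = true).card (B.filter fun v => c v = true).card
    with hle | hle
  · refine ⟨B.filter fun v => c v = true, filter_subset _ _, by omega, fun v hv w hw hvw => ?_⟩
    rw [mem_filter] at hv hw
    exact hc v hv.1 w hw.1 hvw (hv.2.trans hw.2.symm)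
  · refine ⟨B.filter fun v => ¬ c v = true, filter_subset _ _, by omega, fun v hv w hw hvw => ?_⟩
    rw [mem_filter] at hv hw
    refine hc v hv.1 w hw.1 hvw ?_
    rw [Bool.not_eq_true] at hv hw
    exact hv.2.trans hw.2.symm

/-- Among edges `f v`, `v ∈ I`, each meeting `e` in its own vertex `v`, all but `triCount E e` can
be chosen pairwise disjoint outside `e`. -/
lemma exists_disjoint_of_triCount {e : Finset V} {I : Finset V} (hIe : I ⊆ e)
    (hfE : ∀ v ∈ I, f v ∈ E) (hmem : ∀ v ∈ I, v ∈ f v) (hne : ∀ v ∈ I, f v ≠ e)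
    (hind : ∀ v ∈ I, ∀ w ∈ I, v ≠ w → w ∉ f v) :
    ∃ I' ⊆ I, I.card ≤ I'.card + triCount E e ∧
      ∀ v ∈ I', ∀ w ∈ I', v ≠ w → Disjoint (f v \ e) (f w \ e) := by
  have hinj : ∀ v ∈ I, ∀ w ∈ I, f v = f w → v = w := by
    intro v hv w hw h
    by_contra hvw
    exact hind v hv w hw hvw (h ▸ hmem w hw)
  obtain ⟨F, hF⟩ : ∃ F : Finset (Finset V), ∀ I', I' ∈ F ↔ I' ∈ I.powerset ∧
      ∀ v ∈ I', ∀ w ∈ I', v ≠ w → Disjoint (f v \ e) (f w \ e) := ⟨_, fun I' => mem_filter⟩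
  obtain ⟨I', hI', hmax⟩ := exists_max_image F card
    ⟨∅, (hF ∅).2 ⟨empty_mem_powerset I, by simp⟩⟩
  rw [hF, mem_powerset] at hI'
  refine ⟨I', hI'.1, ?_, hI'.2⟩
  have hconf : ∀ v ∈ I \ I', ∃ w ∈ I', ¬ Disjoint (f v \ e) (f w \ e) := by
    intro v hv
    rw [Finset.mem_sdiff] at hv
    by_contra! hcon
    have := hmax (insert v I') ((hF _).2 ⟨mem_powerset.2 (insert_subset hv.1 hI'.1), ?_⟩)
    · rw [card_insert_of_notMem hv.2] at this
      omega
    · intro a ha b hb hab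
      rcases mem_insert.1 ha with ha' | ha'
      · rcases mem_insert.1 hb with hb' | hb'
        · exact absurd (ha'.trans hb'.symm) hab
        · exact ha' ▸ hcon b hb'
      · rcases mem_insert.1 hb with hb' | hb'
        · exact hb' ▸ (hcon a ha').symm
        · exact hI'.2 a ha' b hb' hab
  choose! g hg hgd using hconf
  have hcard : (I \ I').card ≤ triCount E e := by
    refine card_le_card_of_injOn (fun v => {f v, f (g v)}) ?_ ?_
    · intro v hv
      have hv' := Finset.mem_sdiff.1 (mem_coe.1 hv)
      have hgI := hI'.1 (hg v hv)
      have hvg : v ≠ g v := fun h => hv'.2 (h ▸ hg v hv)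
      have hfne : f v ≠ f (g v) := fun h => hvg (hinj v hv'.1 _ hgI h)
      obtain ⟨z, hz1, hz2⟩ := Finset.not_disjoint_iff.1 (hgd v hv)
      rw [Finset.mem_sdiff] at hz1 hz2
      refine mem_coe.2 (mem_filter.2 ⟨mem_powersetCard.2 ⟨?_, card_pair hfne⟩, f v, by simp,
        f (g v), by simp, hfne, (hne v hv'.1).symm, (hne _ hgI).symm, hfne, ⟨v, ?_⟩, ⟨g v, ?_⟩,
        ⟨z, ?_⟩⟩)
      · intro s hs
        rcases mem_insert.1 hs with rfl | hs
        · exact hfE v hv'.1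
        · rw [mem_singleton.1 hs]
          exact hfE _ hgI
      · exact Finset.mem_sdiff.2 ⟨mem_inter.2 ⟨hIe hv'.1, hmem v hv'.1⟩,
          hind _ hgI v hv'.1 hvg.symm⟩
      · exact Finset.mem_sdiff.2 ⟨mem_inter.2 ⟨hIe hgI, hmem _ hgI⟩, hind v hv'.1 _ hgI hvg⟩
      · exact Finset.mem_sdiff.2 ⟨mem_inter.2 ⟨hz1.1, hz2.1⟩, hz1.2⟩
    · intro v hv w hw hvw
      have hv' := Finset.mem_sdiff.1 (mem_coe.1 hv)
      have hw' := Finset.mem_sdiff.1 (mem_coe.1 hw)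
      have : f v ∈ ({f w, f (g w)} : Finset (Finset V)) := by
        rw [← show ({f v, f (g v)} : Finset (Finset V)) = {f w, f (g w)} from hvw]
        simp
      rcases mem_insert.1 this with h | h
      · exact hinj v hv'.1 w hw'.1 h
      · have := hinj v hv'.1 _ (hI'.1 (hg w hw)) (mem_singleton.1 h)
        exact absurd (this ▸ hg w hw) hv'.2
  have := card_sdiff_add_card_eq_card hI'.1
  omega

lemma IsProcess.exists_chainEvent (h : IsProcess E J T ω R f τ) (hE : ∀ e ∈ E, e.card = k)
    (hS : TwoSimple E) {e : Finset V} (he : e ∈ E) {α : Fin r}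
    (hα : ∀ u ∈ e, recolor ω R u = α) {x : ℕ} (hT : T < (e ∩ R).card)
    (hx : 2 * (x + triCount E e) ≤ T) :
    ∃ (v : Fin x → V) (f A : Fin x → Finset V), IsChain k e v f A ∧ (∀ i, f i ∈ E) ∧
      (∀ i, (A i).card ≤ T) ∧ ChainEvent J e α v f A ω := by
  have hlt : ∀ v ∈ e ∩ R, ∀ u ∈ e ∩ R, u ∈ f v → u ≠ v → τ v < τ u := fun v hv u hu huf hne =>
    h.lt_of_mem hα hv huf (mem_inter.1 hu).1 hne
  have hB : T ≤ ((e ∩ R).filter fun v => f v ≠ e).card := by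
    have h1 : ((e ∩ R).filter fun v => ¬ f v ≠ e).card ≤ 1 := by
      refine Finset.card_le_one.2 fun v hv w hw => ?_
      rw [mem_filter, not_not] at hv hw
      by_contra hne
      have h1 := hlt v hv.1 w hw.1 (hv.2 ▸ (mem_inter.1 hw.1).1) (Ne.symm hne)
      have h2 := hlt w hw.1 v hv.1 (hw.2 ▸ (mem_inter.1 hv.1).1) hne
      omega
    have h2 := Finset.card_filter_add_card_filter_not (s := e ∩ R) (fun v => f v ≠ e)
    omega
  have hBmem : ∀ v ∈ (e ∩ R).filter fun v => f v ≠ e, v ∈ e ∩ R ∧ f v ≠ e := fun v hv =>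
    mem_filter.1 hv
  generalize ((e ∩ R).filter fun v => f v ≠ e) = B at hB hBmem
  have hinter : ∀ v ∈ B, (f v ∩ e).card ≤ 2 := fun v hv =>
    hS _ (h.edge v (mem_inter.1 (hBmem v hv).1).2) e he (hBmem v hv).2
  obtain ⟨I, hIB, hI, hind⟩ := exists_independent B τ (fun v w => w ∈ f v ∧ w ≠ v)
    (fun v hv w hw hvw => hlt v (hBmem v hv).1 w (hBmem w hw).1 hvw.1 hvw.2) (by
      intro v hv w hw w' hw' hvw hvw'
      by_contra hne
      have hsub : ({v, w, w'} : Finset V) ⊆ f v ∩ e := by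
        intro u hu
        simp only [mem_insert, mem_singleton] at hu
        rcases hu with rfl | rfl | rfl
        · exact mem_inter.2 ⟨h.mem _ (mem_inter.1 (hBmem _ hv).1).2, (mem_inter.1 (hBmem _ hv).1).1⟩
        · exact mem_inter.2 ⟨hvw.1, (mem_inter.1 (hBmem _ hw).1).1⟩
        · exact mem_inter.2 ⟨hvw'.1, (mem_inter.1 (hBmem _ hw').1).1⟩
      have h3 : ({v, w, w'} : Finset V).card = 3 :=
        card_eq_three.2 ⟨v, w, w', hvw.2.symm, hvw'.2.symm, hne, rfl⟩
      have := (Finset.card_le_card hsub).trans (hinter v hv)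
      omega)
  have hImem : ∀ v ∈ I, v ∈ e ∩ R := fun v hv => (hBmem v (hIB hv)).1
  have hIR : ∀ v ∈ I, v ∈ R := fun v hv => (mem_inter.1 (hImem v hv)).2
  obtain ⟨I', hI'I, hI', hdisj⟩ := exists_disjoint_of_triCount (E := E) (f := f) (e := e) (I := I)
    (fun v hv => (mem_inter.1 (hImem v hv)).1) (fun v hv => h.edge v (hIR v hv))
    (fun v hv => h.mem v (hIR v hv)) (fun v hv => (hBmem v (hIB hv)).2)
    (fun v hv w hw hvw hwf => hind v hv w hw ⟨hwf, hvw.symm⟩)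
  obtain ⟨I'', hI''I', hI''⟩ := exists_subset_card_eq (show x ≤ I'.card by omega)
  obtain ⟨v, hv, hvinj⟩ : ∃ v : Fin x → V, (∀ i, v i ∈ I'') ∧ Function.Injective v :=
    ⟨fun i => ((equivFinOfCardEq hI'').symm i : I''), fun i => Subtype.prop _, fun i j h' =>
      (equivFinOfCardEq hI'').symm.injective (Subtype.ext h')⟩
  have hvI' : ∀ i, v i ∈ I' := fun i => hI''I' (hv i)
  have hvI : ∀ i, v i ∈ I := fun i => hI'I (hvI' i)
  have hvR : ∀ i, v i ∈ R := fun i => hIR _ (hvI i)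
  have hve : ∀ i, v i ∈ e := fun i => (mem_inter.1 (hImem _ (hvI i))).1
  have hprop := fun i (u : V) (hu : u ∈ f (v i)) hue => h.props_of_mem hα (hImem _ (hvI i)) hu hue
  refine ⟨v, fun i => f (v i), fun i => (f (v i)).filter fun u => u ∈ R ∧ τ u < τ (v i),
    ⟨hE e he, fun i => hE _ (h.edge _ (hvR i)), hve, fun i => h.mem _ (hvR i), ?_,
      fun i => hinter _ (hIB (hvI i)), ?_, ?_⟩, fun i => h.edge _ (hvR i),
    fun i => h.card_le _ (hvR i), ?_, ?_, ?_⟩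
  · exact fun i j hij hj => hind _ (hvI i) _ (hvI j) ⟨hj, fun h' => hij (hvinj h').symm⟩
  · exact fun i j hij => hdisj _ (hvI' i) _ (hvI' j) fun h' => hij (hvinj h')
  · intro i u hu
    rw [mem_filter] at hu
    exact Finset.mem_sdiff.2 ⟨hu.1, fun hue => (hprop i u hu.1 hue).2.1 hu.2.2⟩
  · intro u hu
    have hu' := hα u hu
    rw [recolor] at hu'
    split_ifs at hu' with huR
    · exact Or.inr ⟨hu', h.free u huR⟩
    · exact Or.inl hu'
  · intro i u hu hue
    have := hprop i u hu hue
    exact ⟨this.2.2.1, this.2.2.2, h.free u this.1⟩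
  · intro i u hu _
    refine ⟨fun hA => ?_, fun hA => h.col_eq _ (hvR i) u hu fun h' => hA (mem_filter.2 ⟨hu, h'⟩)⟩
    rw [mem_filter] at hA
    exact ⟨h.alt_eq _ (hvR i) u hu hA.2.1 hA.2.2, h.free u hA.2.1⟩

/-- If none of the bad events happens, then there is a proper coloring. -/
lemma rColorable_of_forall_not (hk : 0 < k) (hE : ∀ e ∈ E, e.card = k) (hS : TwoSimple E) {x : ℕ}
    (hx : ∀ e ∈ E, 2 * (x + triCount E e) ≤ T) (ω : V → State r k)
    (h1 : ∀ e ∈ E, ∀ (α : Fin r), ∀ A ⊆ e, A.card ≤ T → ¬ StuckEvent J e α A ω)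
    (h2 : ∀ e ∈ E, ∀ (α : Fin r) (v : Fin x → V) (f A : Fin x → Finset V), IsChain k e v f A →
      (∀ i, f i ∈ E) → (∀ i, (A i).card ≤ T) → ¬ ChainEvent J e α v f A ω) :
    RColorable r E := by
  obtain ⟨R, f, τ, h, hmax⟩ := exists_maximal_process E J T ω
  refine ⟨recolor ω R, fun e he hmono => ?_⟩
  obtain ⟨v, hv⟩ : e.Nonempty := card_pos.1 (by rw [hE e he]; exact hk)
  have hα : ∀ u ∈ e, recolor ω R u = recolor ω R v := fun u hu => hmono u hu v hv
  generalize recolor ω R v = α at hα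
  rcases lt_or_ge T (e ∩ R).card with hT | hT
  · obtain ⟨v, f, A, hc, hf, hA, hev⟩ := h.exists_chainEvent hE hS he hα hT (hx e he)
    exact h2 e he α v f A hc hf hA hev
  · refine h1 e he α (e ∩ R) inter_subset_left hT fun u hu => ?_
    have hu' := hα u hu
    rw [recolor] at hu'
    split_ifs at hu' with huR
    · exact ⟨fun _ => ⟨hu', h.free u huR⟩, fun hn => absurd (mem_inter.2 ⟨hu, huR⟩) hn⟩
    · refine ⟨fun hn => absurd (mem_inter.1 hn).2 huR, fun _ => ⟨hu', fun hfree => ?_⟩⟩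
      have := hmax _ _ _ (h.extend he hα hT hu huR hfree)
      rw [card_insert_of_notMem huR] at this
      omega

end Recoloring

section Sums

lemma sum_piFinset_mul_prod_le {κ ε : Type*} {x : ℕ} (E : Finset ε) (S : Finset κ) (g ν : κ → ℝ)
    (m : ε → ℝ) (ρ : κ → ε → ℝ) {d B : ℝ} (hd : 0 ≤ d) (hB : 0 ≤ B) (hg : ∀ c, 0 ≤ g c)
    (hν : ∀ c, 0 ≤ ν c) (hm : ∀ e, 0 ≤ m e) (hρ : ∀ c e, 0 ≤ ρ c e) (hmd : ∑ e ∈ E, m e ≤ d)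
    (hρd : ∀ c ∈ S, ∑ e ∈ E, ρ c e ≤ d) (hρB : ∀ e ∈ E, ∑ c ∈ S, ρ c e * g c ≤ B)
    (hνB : ∑ c ∈ S, ν c * g c ≤ B) :
    ∑ e ∈ E, ∑ c ∈ Fintype.piFinset (fun _ : Fin x => S),
      (m e + ∑ j, ν (c j)) * ∏ j, (ρ (c j) e * g (c j)) ≤ (x + 1) * d * B ^ x := by
  have h1 : ∀ e ∈ E, ∑ c ∈ Fintype.piFinset (fun _ : Fin x => S),
      m e * ∏ j, (ρ (c j) e * g (c j)) ≤ m e * B ^ x := by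
    intro e he
    rw [← mul_sum, ← prod_univ_sum (fun _ : Fin x => S) fun _ c => ρ c e * g c, prod_const,
      card_univ, Fintype.card_fin]
    refine mul_le_mul_of_nonneg_left (pow_le_pow_left₀ ?_ (hρB e he) x) (hm e)
    exact sum_nonneg fun c _ => mul_nonneg (hρ c e) (hg c)
  have h2 : ∀ j : Fin x, ∀ e ∈ E, ∑ c ∈ Fintype.piFinset (fun _ : Fin x => S),
      ν (c j) * ∏ i, (ρ (c i) e * g (c i)) ≤ (∑ c ∈ S, ν c * (ρ c e * g c)) * B ^ (x - 1) := by
    intro j e he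
    have h3 : ∀ c : Fin x → κ, ν (c j) * ∏ i, (ρ (c i) e * g (c i)) =
        ∏ i, (if i = j then ν (c i) else 1) * (ρ (c i) e * g (c i)) := by
      intro c
      rw [prod_mul_distrib (f := fun i => if i = j then ν (c i) else 1), prod_ite_eq' univ j,
        if_pos (mem_univ j)]
    simp only [h3]
    rw [← prod_univ_sum (fun _ : Fin x => S)
      fun i c => (if i = j then ν c else 1) * (ρ c e * g c),
      ← mul_prod_erase univ _ (mem_univ j)]
    simp only [if_true]
    refine mul_le_mul_of_nonneg_left ?_
      (sum_nonneg fun c _ => mul_nonneg (hν c) (mul_nonneg (hρ c e) (hg c)))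
    rw [prod_congr rfl (g := fun _ => ∑ c ∈ S, ρ c e * g c) fun i hi => by
      simp only [if_neg (ne_of_mem_erase hi), one_mul], prod_const, card_erase_of_mem (mem_univ j),
      card_univ, Fintype.card_fin]
    refine pow_le_pow_left₀ ?_ (hρB e he) _
    exact sum_nonneg fun c _ => mul_nonneg (hρ c e) (hg c)
  have h4 : ∀ j : Fin x, ∑ e ∈ E, ∑ c ∈ Fintype.piFinset (fun _ : Fin x => S),
      ν (c j) * ∏ i, (ρ (c i) e * g (c i)) ≤ d * B ^ x := by
    intro j
    have h5 : ∑ e ∈ E, ∑ c ∈ S, ν c * (ρ c e * g c) ≤ d * B := by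
      rw [sum_comm]
      calc _ ≤ ∑ c ∈ S, d * (ν c * g c) := by
            refine sum_le_sum fun c hc => ?_
            calc _ = (∑ e ∈ E, ρ c e) * (ν c * g c) := by
                  rw [sum_mul]
                  exact sum_congr rfl fun e _ => by ring
              _ ≤ _ := mul_le_mul_of_nonneg_right (hρd c hc) (mul_nonneg (hν c) (hg c))
        _ = d * ∑ c ∈ S, ν c * g c := by rw [mul_sum]
        _ ≤ _ := mul_le_mul_of_nonneg_left hνB hd
    calc _ ≤ ∑ e ∈ E, (∑ c ∈ S, ν c * (ρ c e * g c)) * B ^ (x - 1) :=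
          sum_le_sum fun e he => h2 j e he
      _ = (∑ e ∈ E, ∑ c ∈ S, ν c * (ρ c e * g c)) * B ^ (x - 1) := by rw [sum_mul]
      _ ≤ (d * B) * B ^ (x - 1) := mul_le_mul_of_nonneg_right h5 (by positivity)
      _ = d * B ^ x := by
        have : x = (x - 1) + 1 := by have := j.pos; omega
        conv_rhs => rw [this, pow_succ]
        ring
  calc _ = ∑ e ∈ E, ∑ c ∈ Fintype.piFinset (fun _ : Fin x => S),
        m e * ∏ j, (ρ (c j) e * g (c j)) + ∑ j : Fin x, ∑ e ∈ E,
        ∑ c ∈ Fintype.piFinset (fun _ : Fin x => S), ν (c j) * ∏ i, (ρ (c i) e * g (c i)) := by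
        rw [sum_comm (s := univ), ← sum_add_distrib]
        refine sum_congr rfl fun e _ => ?_
        rw [sum_comm (s := univ), ← sum_add_distrib]
        refine sum_congr rfl fun c _ => ?_
        rw [add_mul, sum_mul]
    _ ≤ ∑ e ∈ E, m e * B ^ x + ∑ _j : Fin x, d * B ^ x :=
        add_le_add (sum_le_sum h1) (sum_le_sum fun j _ => h4 j)
    _ ≤ d * B ^ x + x * (d * B ^ x) := by
        rw [← sum_mul, sum_const, card_univ, Fintype.card_fin, nsmul_eq_mul]
        gcongr
    _ = _ := by ring

variable {V : Type*} {r k : ℕ}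

/-- The subsets of `e` with at most `T` elements. -/
def smallSubsets (T : ℕ) (e : Finset V) : Finset (Finset V) :=
  e.powerset.filter fun A => A.card ≤ T

lemma mem_smallSubsets {T : ℕ} {e A : Finset V} : A ∈ smallSubsets T e ↔ A ⊆ e ∧ A.card ≤ T := by
  rw [smallSubsets, mem_filter, mem_powerset]

lemma sum_smallSubsets_pow_le {T : ℕ} (e : Finset V) {p s : ℝ} (hp : 0 ≤ p) (hs : 1 ≤ s) :
    ∑ A ∈ smallSubsets T e, p ^ A.card ≤ s ^ T * Real.exp (e.card * p / s) := by
  have hs0 : 0 < s := by linarith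
  calc ∑ A ∈ smallSubsets T e, p ^ A.card ≤ ∑ A ∈ smallSubsets T e, s ^ T * (p / s) ^ A.card := by
        refine sum_le_sum fun A hA => ?_
        have h1 : s ^ A.card ≤ s ^ T := pow_le_pow_right₀ hs (mem_smallSubsets.1 hA).2
        rw [div_pow, mul_div_assoc', le_div_iff₀ (by positivity), mul_comm]
        exact mul_le_mul_of_nonneg_right h1 (by positivity)
    _ ≤ ∑ A ∈ e.powerset, s ^ T * (p / s) ^ A.card :=
        sum_le_sum_of_subset_of_nonneg (filter_subset _ _) fun A _ _ => by positivity
    _ = s ^ T * (p / s + 1) ^ e.card := by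
        rw [← sum_pow_mul_eq_add_pow, mul_sum]
        simp
    _ ≤ s ^ T * (Real.exp (p / s)) ^ e.card := by
        gcongr
        exact Real.add_one_le_exp _
    _ = _ := by
        rw [← Real.exp_nat_mul, mul_div_assoc]

/-- The links of a chain: an edge of `E`, one of its vertices, and a small set of vertices
of the edge. -/
def links (E : Finset (Finset V)) (T : ℕ) : Finset (Σ _ : Finset V, V × Finset V) :=
  E.sigma fun f => f ×ˢ smallSubsets T f

/-- The weight of a link. -/
noncomputable def linkWeight (r k J : ℕ) (c : Σ _ : Finset V, V × Finset V) : ℝ :=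
  16 * (J / k : ℝ) * (r : ℝ)⁻¹ ^ (k - 1) * (J / k : ℝ) ^ c.2.2.card

lemma sum_links_le {E : Finset (Finset V)} (hr : 2 ≤ r) (hk : 2 ≤ k) (hE : ∀ e ∈ E, e.card = k)
    {T J : ℕ} {s : ℝ} (hs : 1 ≤ s) {w : Finset V → V → ℝ} (hw : ∀ f v, 0 ≤ w f v) {N : ℝ}
    (hN : ∑ f ∈ E, ∑ v ∈ f, w f v ≤ k * (N * r ^ (k - 1))) :
    ∑ c ∈ links E T, w c.1 c.2.1 * linkWeight r k J c ≤
      16 * J * N * (s ^ T * Real.exp (J / s)) := by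
  have hk0 : (0 : ℝ) < k := by positivity
  have hr0 : (0 : ℝ) < r := by positivity
  rw [links, sum_sigma]
  have key : ∀ f ∈ E, ∑ y ∈ f ×ˢ smallSubsets T f, w f y.1 * linkWeight r k J ⟨f, y⟩ ≤
      (∑ v ∈ f, w f v) * (16 * (J / k : ℝ) * (r : ℝ)⁻¹ ^ (k - 1) *
        (s ^ T * Real.exp (J / s))) := by
    intro f hf
    have h1 := sum_smallSubsets_pow_le (T := T) f (p := J / k) (by positivity) hs
    rw [hE f hf, mul_div_cancel₀ _ hk0.ne'] at h1
    rw [sum_product, sum_mul]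
    refine sum_le_sum fun v _ => ?_
    simp only [linkWeight]
    rw [← mul_sum, ← mul_sum]
    have := hw f v
    gcongr
  refine (sum_le_sum key).trans ?_
  rw [← sum_mul]
  calc _ ≤ (k * (N * r ^ (k - 1))) * (16 * (J / k : ℝ) * (r : ℝ)⁻¹ ^ (k - 1) *
        (s ^ T * Real.exp (J / s))) := mul_le_mul_of_nonneg_right hN (by positivity)
    _ = ((r : ℝ) ^ (k - 1) * (r : ℝ)⁻¹ ^ (k - 1)) * (k * (J / k : ℝ)) *
        (16 * N * (s ^ T * Real.exp (J / s))) := by ring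
    _ = _ := by
      rw [← mul_pow, mul_inv_cancel₀ hr0.ne', one_pow, mul_div_cancel₀ _ hk0.ne']
      ring

variable [DecidableEq V]

lemma sum_ite_mem_eq_card (E : Finset (Finset V)) (v : V) :
    ∑ e ∈ E, (if v ∈ e then (1 : ℝ) else 0) = ((E.filter fun e => v ∈ e).card : ℝ) := by
  rw [sum_boole]

lemma inv_one_sub_inv_nonneg (k : ℕ) : 0 ≤ (1 - (k : ℝ)⁻¹)⁻¹ :=
  inv_nonneg.2 (sub_nonneg.2 (Nat.cast_inv_le_one k))

lemma inv_one_sub_inv_pow_le (hk : 2 ≤ k) : ((1 - (k : ℝ)⁻¹)⁻¹) ^ k ≤ 8 := by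
  have hk2 : (2 : ℝ) ≤ k := by exact_mod_cast hk
  have hpos : 0 < 1 - (k : ℝ)⁻¹ := by
    have : (k : ℝ)⁻¹ ≤ 2⁻¹ := inv_anti₀ (by norm_num) hk2
    linarith
  have h1 : (1 - (k : ℝ)⁻¹)⁻¹ ≤ Real.exp (2 / k) := by
    have h2 : (1 - (k : ℝ)⁻¹)⁻¹ = 1 / (k - 1) + 1 := by
      have : (k : ℝ) - 1 ≠ 0 := by linarith
      field_simp
      ring
    rw [h2]
    refine le_trans ?_ (Real.add_one_le_exp _)
    rw [add_le_add_iff_right, div_le_div_iff₀ (by linarith) (by linarith)]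
    linarith
  calc _ ≤ Real.exp (2 / k) ^ k := pow_le_pow_left₀ (by positivity) h1 k
    _ = Real.exp 1 * Real.exp 1 := by
      rw [← Real.exp_nat_mul, ← Real.exp_add]
      congr 1
      field_simp
      norm_num
    _ ≤ 8 := by
      have := Real.exp_one_lt_d9
      have := Real.exp_pos 1
      nlinarith

/-- The total weight of the events that an edge through `v` is stuck. -/
lemma sum_stuck_le {E : Finset (Finset V)} (hr : 2 ≤ r) (hk : 2 ≤ k) (hE : ∀ e ∈ E, e.card = k)
    {T J : ℕ} {l s : ℝ} (hs : 1 ≤ s) (hJ : J ≤ k) {v : V}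
    (hdeg : ((E.filter fun e => v ∈ e).card : ℝ) ≤ l * r ^ (k - 1)) :
    ∑ i ∈ E.sigma (fun e => (univ : Finset (Fin r)) ×ˢ smallSubsets T e),
      (if v ∈ i.1 then ((r : ℝ)⁻¹ ^ k * ((J / k : ℝ) ^ i.2.2.card * (1 - J / k : ℝ) ^ (k - T))) *
        ((1 - (k : ℝ)⁻¹)⁻¹) ^ i.1.card else 0) ≤
      8 * l * (s ^ T * Real.exp (J / s)) * (1 - J / k : ℝ) ^ (k - T) := by
  have hk0 : (0 : ℝ) < k := by positivity
  have hr0 : (0 : ℝ) < r := by positivity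
  have hp1 : (J / k : ℝ) ≤ 1 := by
    rw [div_le_one hk0]
    exact_mod_cast hJ
  have hp1' : 0 ≤ 1 - (J / k : ℝ) := by linarith
  rw [sum_sigma]
  have hQ : 0 ≤ s ^ T * Real.exp (J / s) := by positivity
  have key : ∀ e ∈ E, ∑ y ∈ (univ : Finset (Fin r)) ×ˢ smallSubsets T e,
      (if v ∈ e then ((r : ℝ)⁻¹ ^ k * ((J / k : ℝ) ^ y.2.card * (1 - J / k : ℝ) ^ (k - T))) *
        ((1 - (k : ℝ)⁻¹)⁻¹) ^ e.card else 0) ≤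
      (if v ∈ e then (1 : ℝ) else 0) * (r * ((r : ℝ)⁻¹ ^ k *
        ((s ^ T * Real.exp (J / s)) * (1 - J / k : ℝ) ^ (k - T)) * 8)) := by
    intro e he
    split_ifs with hv
    · have h1 := sum_smallSubsets_pow_le (T := T) e (p := J / k) (by positivity) hs
      rw [hE e he, mul_div_cancel₀ _ hk0.ne'] at h1
      rw [sum_product]
      dsimp only
      rw [sum_const, card_univ, Fintype.card_fin, nsmul_eq_mul, one_mul,
        ← sum_mul, ← mul_sum, ← sum_mul, hE e he]
      have h8 := inv_one_sub_inv_pow_le hk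
      have h80 := inv_one_sub_inv_nonneg k
      gcongr
    · simp
  refine (sum_le_sum key).trans ?_
  rw [← sum_mul, sum_ite_mem_eq_card]
  have hpow : (r : ℝ) ^ (k - 1) * r = r ^ k := by
    rw [← pow_succ]; congr 1; omega
  calc _ ≤ (l * r ^ (k - 1)) * (r * ((r : ℝ)⁻¹ ^ k *
        ((s ^ T * Real.exp (J / s)) * (1 - J / k : ℝ) ^ (k - T)) * 8)) :=
        mul_le_mul_of_nonneg_right hdeg (by positivity)
    _ = ((r : ℝ) ^ (k - 1) * r * (r : ℝ)⁻¹ ^ k) *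
        (8 * l * (s ^ T * Real.exp (J / s)) * (1 - J / k : ℝ) ^ (k - T)) := by ring
    _ = _ := by
      rw [hpow, ← mul_pow, mul_inv_cancel₀ hr0.ne', one_pow, one_mul]

end Sums

section Main

variable {V : Type*} [DecidableEq V] {r k : ℕ}

/-- The domain of the event of a chain. -/
def chainDomain {x : ℕ} (e : Finset V) (c : Fin x → Σ _ : Finset V, V × Finset V) : Finset V :=
  e ∪ univ.biUnion fun j => (c j).1

/-- The total weight of the chain events whose domain contains `v`. -/
lemma sum_chain_le {E : Finset (Finset V)} (hr : 2 ≤ r) (hk : 2 ≤ k) (hE : ∀ e ∈ E, e.card = k)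
    {T J x : ℕ} {l s : ℝ} (hl : 0 ≤ l) (hs : 1 ≤ s) (v : V)
    (hdeg : ∀ v, ((E.filter fun e => v ∈ e).card : ℝ) ≤ l * r ^ (k - 1))
    (I : Finset (Σ _ : Finset V, Fin r × (Fin x → Σ _ : Finset V, V × Finset V)))
    (hI : ∀ i ∈ I, i.1 ∈ E ∧ (∀ j, i.2.2 j ∈ links E T) ∧ ∀ j, (i.2.2 j).2.1 ∈ i.1) :
    ∑ i ∈ I, (if v ∈ chainDomain i.1 i.2.2 then ((r : ℝ)⁻¹ ^ k * (1 + J / k : ℝ) ^ k *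
        ∏ j, (2 * (J / k : ℝ) * (r : ℝ)⁻¹ ^ (k - 1) * (J / k : ℝ) ^ (i.2.2 j).2.2.card)) *
        ((1 - (k : ℝ)⁻¹)⁻¹) ^ (chainDomain i.1 i.2.2).card else 0) ≤
      8 * (x + 1) * l * (1 + J / k : ℝ) ^ k *
        (16 * J * l * (s ^ T * Real.exp (J / s))) ^ x := by
  have hk0 : (0 : ℝ) < k := by positivity
  have hr0 : (0 : ℝ) < r := by positivity
  set m : Finset V → ℝ := fun e => if v ∈ e then 1 else 0 with hm
  set ν : (Σ _ : Finset V, V × Finset V) → ℝ := fun c => if v ∈ c.1 then 1 else 0 with hν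
  set ρ : (Σ _ : Finset V, V × Finset V) → Finset V → ℝ :=
    fun c e => if c.2.1 ∈ e then 1 else 0 with hρ
  have hm0 : ∀ e, 0 ≤ m e := fun e => by simp only [hm]; split_ifs <;> norm_num
  have hν0 : ∀ c, 0 ≤ ν c := fun c => by simp only [hν]; split_ifs <;> norm_num
  have hρ0 : ∀ c e, 0 ≤ ρ c e := fun c e => by simp only [hρ]; split_ifs <;> norm_num
  have hg0 : ∀ c : Σ _ : Finset V, V × Finset V, 0 ≤ linkWeight r k J c := fun c => by
    rw [linkWeight]; positivity
  set c₀ : ℝ := (r : ℝ)⁻¹ ^ k * (1 + J / k : ℝ) ^ k * 8 with hc₀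
  have hterm : ∀ i ∈ I, (if v ∈ chainDomain i.1 i.2.2 then
      ((r : ℝ)⁻¹ ^ k * (1 + J / k : ℝ) ^ k *
        ∏ j, (2 * (J / k : ℝ) * (r : ℝ)⁻¹ ^ (k - 1) * (J / k : ℝ) ^ (i.2.2 j).2.2.card)) *
        ((1 - (k : ℝ)⁻¹)⁻¹) ^ (chainDomain i.1 i.2.2).card else 0) ≤
      c₀ * ((m i.1 + ∑ j, ν (i.2.2 j)) * ∏ j, (ρ (i.2.2 j) i.1 * linkWeight r k J (i.2.2 j))) := by
    rintro ⟨e, α, c⟩ hi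
    obtain ⟨he, hc, hce⟩ := hI _ hi
    dsimp only at he hc hce ⊢
    have hρ1 : ∀ j, ρ (c j) e = 1 := fun j => if_pos (hce j)
    have hprod0 : 0 ≤ ∏ j, linkWeight r k J (c j) := prod_nonneg fun j _ => hg0 _
    simp only [hρ1, one_mul]
    split_ifs with hv
    · have hone : 1 ≤ m e + ∑ j, ν (c j) := by
        rcases mem_union.1 hv with h | h
        · have h1 : m e = 1 := if_pos h
          have : 0 ≤ ∑ j, ν (c j) := sum_nonneg fun j _ => hν0 _
          linarith
        · obtain ⟨j, -, hj⟩ := mem_biUnion.1 h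
          have h1 : ν (c j) = 1 := if_pos hj
          have h2 := single_le_sum (f := fun j => ν (c j)) (fun j _ => hν0 _) (mem_univ j)
          have h3 := hm0 e
          linarith
      have hcard : (chainDomain e c).card ≤ k * (x + 1) := by
        refine (card_union_le _ _).trans ?_
        have h1 : (univ.biUnion fun j => (c j).1).card ≤ x * k := by
          refine card_biUnion_le.trans ?_
          rw [sum_congr rfl fun j _ => hE _ (mem_sigma.1 (hc j)).1]
          simp
        rw [hE e he]
        linarith
      have hpow : ((1 - (k : ℝ)⁻¹)⁻¹) ^ (chainDomain e c).card ≤ 8 * ∏ _j : Fin x, 8 := by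
        have h1 : 1 ≤ (1 - (k : ℝ)⁻¹)⁻¹ := by
          have h2 : (2 : ℝ) ≤ k := by exact_mod_cast hk
          have h3 : (k : ℝ)⁻¹ ≤ 2⁻¹ := inv_anti₀ (by norm_num) h2
          have h4 : 0 < (k : ℝ)⁻¹ := by positivity
          exact (one_le_inv₀ (by linarith)).2 (by linarith)
        calc _ ≤ ((1 - (k : ℝ)⁻¹)⁻¹) ^ (k * (x + 1)) := pow_le_pow_right₀ h1 hcard
          _ = (((1 - (k : ℝ)⁻¹)⁻¹) ^ k) ^ (x + 1) := pow_mul _ _ _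
          _ ≤ 8 ^ (x + 1) := pow_le_pow_left₀ (pow_nonneg (inv_one_sub_inv_nonneg k) _)
              (inv_one_sub_inv_pow_le hk) _
          _ = _ := by rw [prod_const, card_univ, Fintype.card_fin, pow_succ, mul_comm]
      have h0 : 0 ≤ ∏ j, (2 * (J / k : ℝ) * (r : ℝ)⁻¹ ^ (k - 1) *
          (J / k : ℝ) ^ (c j).2.2.card) := prod_nonneg fun j _ => by positivity
      calc _ ≤ ((r : ℝ)⁻¹ ^ k * (1 + J / k : ℝ) ^ k *
            ∏ j, (2 * (J / k : ℝ) * (r : ℝ)⁻¹ ^ (k - 1) * (J / k : ℝ) ^ (c j).2.2.card)) *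
            (8 * ∏ _j : Fin x, 8) := by gcongr
        _ = c₀ * ∏ j, linkWeight r k J (c j) := by
          have : ∀ j, linkWeight r k J (c j) = (2 * (J / k : ℝ) * (r : ℝ)⁻¹ ^ (k - 1) *
              (J / k : ℝ) ^ (c j).2.2.card) * 8 := fun j => by rw [linkWeight]; ring
          rw [prod_congr rfl fun j _ => this j, prod_mul_distrib (g := fun _ => (8 : ℝ))]
          ring
        _ ≤ _ := by
          refine mul_le_mul_of_nonneg_left ?_ (by positivity)
          exact le_mul_of_one_le_left hprod0 hone
    · have : 0 ≤ m e + ∑ j, ν (c j) := add_nonneg (hm0 e) (sum_nonneg fun j _ => hν0 _)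
      positivity
  have hF0 : ∀ (e : Finset V) (c : Fin x → Σ _ : Finset V, V × Finset V),
      0 ≤ (m e + ∑ j, ν (c j)) * ∏ j, (ρ (c j) e * linkWeight r k J (c j)) := fun e c =>
    mul_nonneg (add_nonneg (hm0 e) (sum_nonneg fun j _ => hν0 _))
      (prod_nonneg fun j _ => mul_nonneg (hρ0 _ _) (hg0 _))
  have hmain := sum_piFinset_mul_prod_le (x := x) E (links E T) (linkWeight r k J) ν m ρ
    (d := l * r ^ (k - 1)) (B := 16 * J * l * (s ^ T * Real.exp (J / s))) (by positivity)
    (by positivity) hg0 hν0 hm0 hρ0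
    (by simp only [hm]; rw [sum_ite_mem_eq_card]; exact hdeg v)
    (fun c _ => by simp only [hρ]; rw [sum_ite_mem_eq_card]; exact hdeg c.2.1)
    (fun e he => by
      refine sum_links_le (w := fun _ u => if u ∈ e then (1 : ℝ) else 0) hr hk hE hs
        (fun _ u => by split_ifs <;> norm_num) ?_
      calc _ = ∑ u ∈ e, ((E.filter fun f => u ∈ f).card : ℝ) := by
            simp only [← sum_ite_mem_eq_card]
            rw [sum_comm]
            refine sum_congr rfl fun f _ => ?_
            rw [sum_boole, sum_boole, filter_mem_eq_inter, filter_mem_eq_inter, inter_comm]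
        _ ≤ ∑ _u ∈ e, l * r ^ (k - 1) := sum_le_sum fun u _ => hdeg u
        _ = _ := by rw [sum_const, hE e he, nsmul_eq_mul])
    (by
      refine sum_links_le (w := fun f _ => if v ∈ f then (1 : ℝ) else 0) hr hk hE hs
        (fun f _ => by split_ifs <;> norm_num) ?_
      calc _ = ∑ f ∈ E, k * (if v ∈ f then (1 : ℝ) else 0) := by
            refine sum_congr rfl fun f hf => ?_
            rw [sum_const, hE f hf, nsmul_eq_mul]
        _ ≤ _ := by
            rw [← mul_sum, sum_ite_mem_eq_card]
            exact mul_le_mul_of_nonneg_left (hdeg v) hk0.le)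
  have hpow : (r : ℝ) ^ (k - 1) * r = r ^ k := by
    rw [← pow_succ]; congr 1; omega
  calc _ ≤ ∑ i ∈ I, c₀ * ((m i.1 + ∑ j, ν (i.2.2 j)) *
          ∏ j, (ρ (i.2.2 j) i.1 * linkWeight r k J (i.2.2 j))) := sum_le_sum hterm
    _ ≤ ∑ i ∈ E.sigma fun _ => (univ : Finset (Fin r)) ×ˢ
          Fintype.piFinset (fun _ : Fin x => links E T), c₀ * ((m i.1 + ∑ j, ν (i.2.2 j)) *
          ∏ j, (ρ (i.2.2 j) i.1 * linkWeight r k J (i.2.2 j))) := by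
        refine sum_le_sum_of_subset_of_nonneg (fun i hi => ?_) fun i _ _ =>
          mul_nonneg (by positivity) (hF0 _ _)
        obtain ⟨h1, h2, -⟩ := hI i hi
        exact mem_sigma.2 ⟨h1, mem_product.2 ⟨mem_univ _, Fintype.mem_piFinset.2 h2⟩⟩
    _ = c₀ * (r * ∑ e ∈ E, ∑ c ∈ Fintype.piFinset (fun _ : Fin x => links E T),
          (m e + ∑ j, ν (c j)) * ∏ j, (ρ (c j) e * linkWeight r k J (c j))) := by
        rw [← mul_sum, sum_sigma]
        congr 1
        rw [mul_sum]
        refine sum_congr rfl fun e _ => ?_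
        rw [sum_product]
        dsimp only
        rw [sum_const, card_univ, Fintype.card_fin, nsmul_eq_mul]
    _ ≤ c₀ * (r * ((x + 1) * (l * r ^ (k - 1)) *
          (16 * J * l * (s ^ T * Real.exp (J / s))) ^ x)) := by gcongr
    _ = ((r : ℝ) ^ (k - 1) * r * (r : ℝ)⁻¹ ^ k) * (8 * (x + 1) * l * (1 + J / k : ℝ) ^ k *
          (16 * J * l * (s ^ T * Real.exp (J / s))) ^ x) := by rw [hc₀]; ring
    _ = _ := by rw [hpow, ← mul_pow, mul_inv_cancel₀ hr0.ne', one_pow, one_mul]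

lemma StuckEvent.update_iff {J : ℕ} {e : Finset V} {α : Fin r} {A : Finset V}
    (ω : V → State r k) {u : V} (hu : u ∉ e) (t : State r k) :
    StuckEvent J e α A (Function.update ω u t) ↔ StuckEvent J e α A ω := by
  refine forall_congr' fun w => forall_congr' fun hw => ?_
  rw [Function.update_of_ne (show w ≠ u by rintro rfl; exact hu hw)]

lemma ChainEvent.update_iff {J x : ℕ} {e : Finset V} {α : Fin r} {v : Fin x → V}
    {f A : Fin x → Finset V} (hv : ∀ i, v i ∈ e) (ω : V → State r k) {u : V}
    (hu : u ∉ e ∪ univ.biUnion f) (t : State r k) :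
    ChainEvent J e α v f A (Function.update ω u t) ↔ ChainEvent J e α v f A ω := by
  have he : ∀ w ∈ e, Function.update ω u t w = ω w := fun w hw =>
    Function.update_of_ne (by rintro rfl; exact hu (mem_union_left _ hw)) _ _
  have hf : ∀ i, ∀ w ∈ f i, Function.update ω u t w = ω w := fun i w hw =>
    Function.update_of_ne (by
      rintro rfl
      exact hu (mem_union_right _ (mem_biUnion.2 ⟨i, mem_univ i, hw⟩))) _ _
  refine and_congr (forall_congr' fun w => forall_congr' fun hw => ?_)
    (and_congr (forall_congr' fun i => forall_congr' fun w => forall_congr' fun hw => ?_)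
      (forall_congr' fun i => forall_congr' fun w => forall_congr' fun hw => ?_))
  · rw [he w hw]
  · rw [hf i w hw, he (v i) (hv i)]
  · rw [hf i w hw, he (v i) (hv i)]

/-- A 2-simple hypergraph with few triangles and small degrees is `r`-colorable. -/
theorem rColorable_of_bounds {E : Finset (Finset V)} (hr : 2 ≤ r) (hk : 2 ≤ k)
    (hE : ∀ e ∈ E, e.card = k) (hS : TwoSimple E) {T J x : ℕ} (hJ : J ≤ k)
    (hx : ∀ e ∈ E, 2 * (x + triCount E e) ≤ T) {l s : ℝ} (hl : 0 ≤ l) (hs : 1 ≤ s)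
    (hdeg : ∀ v, ((E.filter fun e => v ∈ e).card : ℝ) ≤ l * r ^ (k - 1))
    (hstuck : 8 * l * (s ^ T * Real.exp (J / s)) * (1 - J / k : ℝ) ^ (k - T) ≤ (2 * k : ℝ)⁻¹)
    (hchain : 8 * (x + 1) * l * (1 + J / k : ℝ) ^ k *
      (16 * J * l * (s ^ T * Real.exp (J / s))) ^ x ≤ (2 * k : ℝ)⁻¹) :
    RColorable r E := by
  have hk2 : (2 : ℝ) ≤ k := by exact_mod_cast hk
  have hp1 : (J / k : ℝ) ≤ 1 := by
    rw [div_le_one (by linarith)]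
    exact_mod_cast hJ
  have hp1' : 0 ≤ 1 - (J / k : ℝ) := by linarith
  have : Nonempty (State r k) := by
    rw [← Fintype.card_pos_iff, card_state]
    have : 0 < r - 1 := by omega
    positivity
  set I₁ : Finset (Σ _ : Finset V, Fin r × Finset V) :=
    E.sigma (fun e => (univ : Finset (Fin r)) ×ˢ smallSubsets T e)
  obtain ⟨I₂, hI₂⟩ : ∃ I : Finset (Σ _ : Finset V, Fin r × (Fin x → Σ _ : Finset V, V × Finset V)),
      ∀ i, i ∈ I ↔ i ∈ E.sigma (fun _ => (univ : Finset (Fin r)) ×ˢ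
        Fintype.piFinset (fun _ : Fin x => links E T)) ∧
        IsChain k i.1 (fun j => (i.2.2 j).2.1) (fun j => (i.2.2 j).1)
          (fun j => (i.2.2 j).2.2) := ⟨_, fun i => mem_filter⟩
  have hI₂' : ∀ i ∈ I₂, i.1 ∈ E ∧ (∀ j, i.2.2 j ∈ links E T) ∧ ∀ j, (i.2.2 j).2.1 ∈ i.1 := by
    intro i hi
    obtain ⟨h1, h2⟩ := (hI₂ i).1 hi
    obtain ⟨h3, h4⟩ := mem_sigma.1 h1
    exact ⟨h3, Fintype.mem_piFinset.1 (mem_product.1 h4).2, h2.mem_e⟩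
  have h₁ : ∀ v, _ := fun v => sum_stuck_le (T := T) hr hk hE hs hJ (hdeg v)
  have h₂ : ∀ v, _ := fun v => sum_chain_le (J := J) hr hk hE hl hs v hdeg I₂ hI₂'
  refine (exists_forall_not_of_sum_le (V := V) (S := State r k) (I₁.disjSum I₂)
    (Sum.elim (fun i => i.1) fun i => chainDomain i.1 i.2.2)
    (Sum.elim (fun i => StuckEvent J i.1 i.2.1 i.2.2) fun i => ChainEvent J i.1 i.2.1
      (fun j => (i.2.2 j).2.1) (fun j => (i.2.2 j).1) (fun j => (i.2.2 j).2.2))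
    (Sum.elim
      (fun i => (r : ℝ)⁻¹ ^ k * ((J / k : ℝ) ^ i.2.2.card * (1 - J / k : ℝ) ^ (k - T)))
      fun i => (r : ℝ)⁻¹ ^ k * (1 + J / k : ℝ) ^ k *
        ∏ j, (2 * (J / k : ℝ) * (r : ℝ)⁻¹ ^ (k - 1) * (J / k : ℝ) ^ (i.2.2 j).2.2.card))
    (k : ℝ)⁻¹ (by positivity) (inv_lt_one_of_one_lt₀ (by linarith))
    ?_ ?_ ?_ ?_ ?_).elim fun ω hω => ?_
  · rintro (i | i) hi
    · have h := (mem_sigma.1 (inl_mem_disjSum.1 hi)).1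
      refine card_pos.1 ?_
      change 0 < i.1.card
      rw [hE _ h]
      omega
    · have h := (hI₂' i (inr_mem_disjSum.1 hi)).1
      refine Nonempty.mono subset_union_left (card_pos.1 ?_)
      rw [hE _ h]
      omega
  · rintro (i | i) hi ω u hu t
    · exact StuckEvent.update_iff ω hu t
    · exact ChainEvent.update_iff (hI₂' i (inr_mem_disjSum.1 hi)).2.2 ω hu t
  · rintro (i | i) _
    · exact mul_nonneg (by positivity) (mul_nonneg (by positivity) (pow_nonneg hp1' _))
    · exact mul_nonneg (by positivity) (prod_nonneg fun j _ => by positivity)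
  · rintro (i | i) hi G hG
    · obtain ⟨h3, h4⟩ := mem_sigma.1 (inl_mem_disjSum.1 hi)
      obtain ⟨h5, h6⟩ := mem_smallSubsets.1 (mem_product.1 h4).2
      refine (card_stuckEvent_le hr (by omega) hJ i.2.1 h5 G hG).trans ?_
      rw [hE _ h3]
      dsimp only [Sum.elim_inl]
      have h7 : (1 - J / k : ℝ) ^ (k - i.2.2.card) ≤ (1 - J / k : ℝ) ^ (k - T) :=
        pow_le_pow_of_le_one hp1' (sub_le_self _ (by positivity)) (by omega)
      gcongr
    · exact card_chainEvent_le hr hk hJ ((hI₂ i).1 (inr_mem_disjSum.1 hi)).2 G hG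
  · intro v
    rw [sum_disjSum]
    have h3 : (k : ℝ)⁻¹ = (2 * k : ℝ)⁻¹ + (2 * k : ℝ)⁻¹ := by rw [mul_inv]; ring
    refine le_trans (add_le_add ((h₁ v).trans hstuck) ((h₂ v).trans hchain)) h3.ge
  · refine rColorable_of_forall_not (J := J) (by omega) hE hS hx ω (fun e he α A hA hAT => ?_)
      fun e he α v f A hc hf hAT => ?_
    · exact hω (Sum.inl ⟨e, α, A⟩) (inl_mem_disjSum.2 (mem_sigma.2 ⟨he, mem_product.2
        ⟨mem_univ α, mem_smallSubsets.2 ⟨hA, hAT⟩⟩⟩))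
    · refine hω (Sum.inr ⟨e, α, fun j => ⟨f j, v j, A j⟩⟩) (inr_mem_disjSum.2 ((hI₂ _).2
        ⟨mem_sigma.2 ⟨he, mem_product.2 ⟨mem_univ α, Fintype.mem_piFinset.2 fun j => ?_⟩⟩, hc⟩))
      exact mem_sigma.2 ⟨hf j, mem_product.2 ⟨hc.mem_f j, mem_smallSubsets.2
        ⟨(hc.sub j).trans sdiff_subset, hAT j⟩⟩⟩

end Main

section Parameters

set_option maxHeartbeats 1000000 in
lemma exists_parameters {k ω : ℕ} (hk : 3200 ≤ Real.log (2 * Real.log k))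
    (hω : (ω : ℝ) ≤ √(Real.log k / Real.log (Real.log k))) :
    ∃ T J x : ℕ, ∃ s : ℝ, 2 ≤ k ∧ J ≤ k ∧ 2 * (x + ω) ≤ T ∧ 1 ≤ s ∧
      8 * (k : ℝ) ^ (-phi k) * (s ^ T * Real.exp (J / s)) * (1 - J / k : ℝ) ^ (k - T) ≤
        (2 * k : ℝ)⁻¹ ∧
      8 * (x + 1) * (k : ℝ) ^ (-phi k) * (1 + J / k : ℝ) ^ k *
        (16 * J * (k : ℝ) ^ (-phi k) * (s ^ T * Real.exp (J / s))) ^ x ≤ (2 * k : ℝ)⁻¹ := by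
  rw [phi]
  set y := Real.log k with hy
  set Λ := Real.log (2 * y) with hΛ
  have hy0 : 0 < y := by
    refine (Real.log_natCast_nonneg k).lt_of_ne' fun h => ?_
    rw [← hy] at h
    rw [hΛ, h, mul_zero, Real.log_zero] at hk
    norm_num at hk
  have hk0 : (0 : ℝ) < k := by
    rcases Nat.eq_zero_or_pos k with h | h
    · rw [hy, h, Nat.cast_zero, Real.log_zero] at hy0
      exact absurd hy0 (lt_irrefl _)
    · exact_mod_cast h
  have hky : (k : ℝ) = Real.exp y := (Real.exp_log hk0).symm
  set u := Real.exp (Λ / 4) with hu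
  have hΛu : Λ / 4 + 1 ≤ u := Real.add_one_le_exp _
  have hu0 : 801 ≤ u := by linarith
  have hyu : 2 * y = u ^ 4 := by
    rw [hu, ← Real.exp_nat_mul, ← Real.exp_log (show 0 < 2 * y by positivity), ← hΛ]
    congr 1
    push_cast
    ring
  have hu2 : u ^ 2 = Real.exp (Λ / 2) := by
    rw [hu, ← Real.exp_nat_mul]
    congr 1
    push_cast
    ring
  have hu2' : 801 ^ 2 ≤ u ^ 2 := by gcongr
  have hu3 : (801 : ℝ) ^ 3 ≤ u ^ 3 := by gcongr
  have hyΛ : 10000 * Λ ≤ y := by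
    have h1 : 801 ^ 3 * u ≤ u ^ 3 * u := by gcongr
    linarith
  set R := √(y / Λ) with hR
  have hR2 : R ^ 2 = y / Λ := Real.sq_sqrt (by positivity)
  have hR100 : 100 ≤ R := by
    refine Real.le_sqrt_of_sq_le ?_
    rw [le_div_iff₀ (by linarith)]
    linarith
  set t := ⌊R⌋₊ with ht
  have htR : (t : ℝ) ≤ R := Nat.floor_le (by linarith)
  have hRt : R < t + 1 := Nat.lt_floor_add_one R
  have ht99 : (99 : ℝ) ≤ t := by linarith
  have htΛ : (t : ℝ) ^ 2 * Λ ≤ y := by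
    rw [← le_div_iff₀ (by linarith), ← hR2]
    gcongr
  set M := y / t with hM
  have hMt : M * t = y := div_mul_cancel₀ _ (by linarith)
  have hMΛ : t * Λ ≤ M := by
    rw [hM, le_div_iff₀ (by linarith)]
    linarith
  have hM0 : 0 < M := by positivity
  have hMu : 40 * u ^ 2 ≤ M := by
    refine (pow_le_pow_iff_left₀ (by positivity) hM0.le two_ne_zero).1 ?_
    calc (40 * u ^ 2) ^ 2 = 3200 * y := by linear_combination (-1600) * hyu
      _ ≤ Λ * y := by gcongr
      _ = (t * Λ) * M := by rw [← hMt]; ring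
      _ ≤ M ^ 2 := by rw [sq]; gcongr
  set l := (k : ℝ) ^ (-(4 * (t : ℝ)⁻¹)) with hl
  have hlM : l = Real.exp (-(4 * M)) := by
    rw [hl, Real.rpow_def_of_pos hk0, ← hy, hM]
    congr 1
    ring
  have hl1 : l ≤ 1 := by
    rw [hlM]
    exact Real.exp_le_one_iff.2 (by linarith)
  have hl0 : 0 < l := by rw [hlM]; positivity
  set J := ⌈y⌉₊ with hJ
  have hyJ : y ≤ J := Nat.le_ceil y
  have hJy : (J : ℝ) ≤ y + 1 := (Nat.ceil_lt_add_one hy0.le).le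
  have hy1 : 60 ≤ y := by linarith
  have hJ1 : (1 : ℝ) ≤ J := by linarith
  have hJL : (J : ℝ) ≤ u ^ 4 := by linarith
  have hty : (t : ℝ) ≤ y := by
    have h1 : (t : ℝ) ≤ t * (t * Λ) :=
      le_mul_of_one_le_right (by linarith)
        (one_le_mul_of_one_le_of_one_le (by linarith) (by linarith))
    linarith
  have hky3 : 10 * y ^ 2 ≤ k := by
    have h1 := Real.pow_div_factorial_le_exp y hy0.le 3
    rw [← hky] at h1
    refine le_trans ?_ h1
    rw [le_div_iff₀ (by positivity)]
    have h2 : 60 * y ^ 2 ≤ y * y ^ 2 := by gcongr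
    norm_num [Nat.factorial]
    linarith
  have hJT : (J : ℝ) * (5 * t) ≤ k := by
    refine le_trans ?_ hky3
    calc (J : ℝ) * (5 * t) ≤ (2 * y) * (5 * y) := by gcongr; linarith
      _ = _ := by ring
  have hTk : 5 * t ≤ k := by
    have h1 : (5 * t : ℝ) ≤ k := (le_mul_of_one_le_left (by positivity) hJ1).trans hJT
    exact_mod_cast h1
  have hJk : J ≤ k := by
    have h1 : (J : ℝ) ≤ k := (le_mul_of_one_le_right (by positivity) (by linarith)).trans hJT
    exact_mod_cast h1
  have hω' : (ω : ℝ) ≤ 1.05 * t := by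
    have h1 : Real.log y = Λ - Real.log 2 := by
      rw [hΛ, Real.log_mul two_ne_zero hy0.ne']
      ring
    have h2 := Real.log_two_lt_d9
    have h3 : √(y / Real.log y) ≤ 1.02 * R := by
      refine Real.sqrt_le_iff.2 ⟨by positivity, ?_⟩
      rw [mul_pow, hR2, ← mul_div_assoc, div_le_div_iff₀ (by linarith) (by linarith)]
      calc y * Λ ≤ y * (1.02 ^ 2 * Real.log y) := by gcongr; linarith
        _ = _ := by ring
    linarith
  have hω2 : 2 * ω ≤ 5 * t := by
    have h1 : (2 * ω : ℝ) ≤ 5 * t := by linarith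
    exact_mod_cast h1
  set x := 5 * t / 2 - ω with hx
  have hxt : 1.43 * (t : ℝ) ≤ x := by
    have h1 : 5 * t ≤ 2 * x + 2 * ω + 1 := by omega
    have h2 : (5 * t : ℝ) ≤ 2 * x + 2 * ω + 1 := by exact_mod_cast h1
    linarith
  have hu2pos : (0 : ℝ) < u ^ 2 := by positivity
  set Q := (u ^ 2) ^ (5 * t) * Real.exp (J / u ^ 2) with hQ
  have hQ0 : 0 < Q := by positivity
  have hQle : Q ≤ Real.exp (2.5 * M + u ^ 2) := by
    rw [hQ, Real.exp_add]
    refine mul_le_mul ?_ ?_ (by positivity) (by positivity)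
    · rw [hu2, ← Real.exp_nat_mul, Real.exp_le_exp]
      push_cast
      linarith
    · rw [Real.exp_le_exp, div_le_iff₀ hu2pos]
      linarith
  have h32 : (32 : ℝ) ≤ Real.exp 4 := by
    have h1 := Real.exp_one_gt_d9
    have h2 : Real.exp 4 = Real.exp 1 ^ 4 := by
      rw [← Real.exp_nat_mul]
      norm_num
    rw [h2]
    calc (32 : ℝ) ≤ 2.7 ^ 4 := by norm_num
      _ ≤ _ := by gcongr; linarith
  have hB : 32 * J * l * Q ≤ Real.exp (-(1.45 * M)) := by
    calc 32 * J * l * Q ≤ Real.exp 4 * Real.exp Λ * Real.exp (-(4 * M)) *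
          Real.exp (2.5 * M + u ^ 2) := by
          rw [hlM]
          gcongr
          rw [hΛ, Real.exp_log (by positivity)]
          linarith
      _ = Real.exp (4 + Λ + -(4 * M) + (2.5 * M + u ^ 2)) := by simp only [Real.exp_add]
      _ ≤ _ := by
          rw [Real.exp_le_exp]
          have : 801 * u ≤ u * u := by gcongr
          linarith
  have he : Real.exp 1 < 3 := Real.exp_one_lt_d9.trans (by norm_num)
  have hexp : ∀ z, 48 ≤ z → 16 * Real.exp 1 ≤ Real.exp z := fun z hz => by
    have := Real.add_one_le_exp z
    linarith
  refine ⟨5 * t, J, x, u ^ 2, ?_, hJk, by omega, one_le_pow₀ (by linarith), ?_, ?_⟩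
  · have h1 : (J : ℝ) ≤ k := by exact_mod_cast hJk
    have h2 : (2 : ℝ) ≤ k := by linarith
    exact_mod_cast h2
  · have hp : (1 - J / k : ℝ) ^ (k - 5 * t) ≤ Real.exp 1 / k := by
      have hp1 : 0 ≤ 1 - (J / k : ℝ) := by
        rw [sub_nonneg, div_le_one hk0]
        exact_mod_cast hJk
      have hsub : ((k - 5 * t : ℕ) : ℝ) = k - 5 * t := by push_cast [Nat.cast_sub hTk]; ring
      calc _ ≤ Real.exp (-(J / k)) ^ (k - 5 * t) := by
            refine pow_le_pow_left₀ hp1 ?_ _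
            have := Real.add_one_le_exp (-(J / k : ℝ))
            linarith
        _ = Real.exp (J * (5 * t) / k - J) := by
            rw [← Real.exp_nat_mul, hsub]
            congr 1
            field_simp
            ring
        _ ≤ Real.exp (1 - y) := by
            rw [Real.exp_le_exp]
            have : J * (5 * t) / k ≤ (1 : ℝ) := (div_le_one hk0).2 hJT
            linarith
        _ = _ := by rw [Real.exp_sub, ← hky]
    have hlQ : l * Q ≤ Real.exp (-(1.45 * M)) := by
      refine le_trans ?_ hB
      calc l * Q ≤ 32 * J * (l * Q) := le_mul_of_one_le_left (by positivity) (by linarith)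
        _ = _ := by ring
    calc 8 * l * Q * (1 - J / k : ℝ) ^ (k - 5 * t) ≤
          8 * Real.exp (-(1.45 * M)) * (Real.exp 1 / k) := by
          rw [mul_assoc 8]
          refine mul_le_mul ?_ hp ?_ (by positivity)
          · gcongr
          · refine pow_nonneg ?_ _
            rw [sub_nonneg, div_le_one hk0]
            exact_mod_cast hJk
      _ = 16 * Real.exp 1 / Real.exp (1.45 * M) * (2 * k : ℝ)⁻¹ := by
          rw [Real.exp_neg]
          field_simp
          ring
      _ ≤ 1 * (2 * k : ℝ)⁻¹ := by
          gcongr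
          rw [div_le_one (by positivity)]
          exact hexp _ (by linarith)
      _ = _ := one_mul _
  · have hp : (1 + J / k : ℝ) ^ k ≤ Real.exp 1 * k := by
      calc _ ≤ Real.exp (J / k) ^ k := by
            gcongr
            rw [add_comm]
            exact Real.add_one_le_exp _
        _ = Real.exp J := by
            rw [← Real.exp_nat_mul]
            congr 1
            field_simp
        _ ≤ Real.exp (1 + y) := Real.exp_le_exp.2 (by linarith)
        _ = _ := by rw [Real.exp_add, ← hky]
    have hx2 : (x + 1 : ℝ) ≤ 2 ^ x := by exact_mod_cast Nat.lt_two_pow_self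
    have hBx : (32 * J * l * Q) ^ x ≤ Real.exp (-(2.05 * y)) := by
      calc _ ≤ Real.exp (-(1.45 * M)) ^ x := by gcongr
        _ = Real.exp (x * -(1.45 * M)) := (Real.exp_nat_mul _ _).symm
        _ ≤ _ := by
          rw [Real.exp_le_exp]
          have : 1.43 * t * M ≤ x * M := by gcongr
          linarith
    calc 8 * (x + 1) * l * (1 + J / k : ℝ) ^ k * (16 * J * l * Q) ^ x ≤
          8 * 2 ^ x * 1 * (Real.exp 1 * k) * (16 * J * l * Q) ^ x := by gcongr
      _ = 8 * (Real.exp 1 * k) * (32 * J * l * Q) ^ x := by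
          rw [show 32 * J * l * Q = 2 * (16 * J * l * Q) by ring, mul_pow 2]
          ring
      _ ≤ 8 * (Real.exp 1 * k) * Real.exp (-(2.05 * y)) := by gcongr
      _ = 16 * Real.exp 1 / Real.exp (0.05 * y) * (2 * k : ℝ)⁻¹ := by
          rw [hky, Real.exp_neg, show 2.05 * y = 0.05 * y + y + y by ring, Real.exp_add,
            Real.exp_add]
          field_simp
          ring
      _ ≤ 1 * (2 * k : ℝ)⁻¹ := by
          gcongr
          rw [div_le_one (by positivity)]
          exact hexp _ (by linarith)
      _ = _ := one_mul _

end Parameters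

lemma card_filter_mem_le_maxDegree {V : Type*} [DecidableEq V] (E : Finset (Finset V)) (v : V) :
    (E.filter fun e => v ∈ e).card ≤ maxDegree E := by
  by_cases hv : v ∈ E.biUnion id
  · exact le_sup (f := fun v => (E.filter fun e => v ∈ e).card) hv
  · have h : (E.filter fun e => v ∈ e) = ∅ :=
      filter_eq_empty_iff.2 fun e he hve => hv (mem_biUnion.2 ⟨e, he, hve⟩)
    rw [h, card_empty]
    exact Nat.zero_le _

end HG

/-- There exists an integer `k₀` such that for all `k ≥ k₀`, all
`r ≥ 2` and all `ω ≤ √(ln k/(ln ln k))`, every `k`-uniform, 2-simple,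
non-`r`-colorable hypergraph in which every edge lies in at most `ω` 3-cycles
has maximum vertex degree greater than `r^(k−1) k^(−4⌊√(ln k/ln(2 ln k))⌋⁻¹)`
(i.e. `Δ(𝓗(k,r,ω)) > r^(k−1) k^(−φ(k))`). -/
theorem stmt6 :
    ∃ k₀ : ℕ, ∀ k r ω : ℕ, k₀ ≤ k → 2 ≤ r →
      (ω : ℝ) ≤ Real.sqrt (Real.log k / Real.log (Real.log k)) →
      ∀ E : Finset (Finset ℕ),
        (∀ e ∈ E, e.card = k) → HG.TwoSimple E →
        (∀ e ∈ E, HG.triCount E e ≤ ω) → ¬ HG.RColorable r E →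
        (r : ℝ) ^ (k - 1) * (k : ℝ) ^ (-HG.phi k) < (HG.maxDegree E : ℝ) := by
  have hlim : Tendsto (fun k : ℕ => Real.log (2 * Real.log k)) atTop atTop :=
    Real.tendsto_log_atTop.comp <| Tendsto.const_mul_atTop two_pos <|
      Real.tendsto_log_atTop.comp tendsto_natCast_atTop_atTop
  obtain ⟨k₀, hk₀⟩ := eventually_atTop.1 (hlim.eventually_ge_atTop 3200)
  refine ⟨k₀, fun k r ω hk hr hω E hE hS htri hcol => ?_⟩
  by_contra! hdeg
  obtain ⟨T, J, x, s, hk2, hJ, hT, hs, hstuck, hchain⟩ := HG.exists_parameters (hk₀ k hk) hω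
  refine hcol (HG.rColorable_of_bounds hr hk2 hE hS hJ (fun e he => ?_) (by positivity) hs
    (fun v => ?_) hstuck hchain)
  · have := htri e he
    omega
  · rw [mul_comm ((k : ℝ) ^ _)]
    refine le_trans ?_ hdeg
    exact_mod_cast HG.card_filter_mem_le_maxDegree E v
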